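/- arXiv:1403.3064 — 3 statements merged into one kernel-verified Lean document; each statement's English description precedes it below -/
import Mathlib

section
/- Let F be a field of characteristic 2, let u, v ∈ F* be such that E = F(μ,ν) with μ² = u and ν² + ν + v = 0 is a mixed biquadratic extension of degree 4. Set γ = μν; then E = F(γ), the minimal polynomial of γ over F is f(X) = X⁴ + uX² + u²v², and its cubic resolvent is f_C(X) = X³ + uX². Moreover, for e ∈ F* with f_C(e) ≠ 0 and r = uv/e, one has the identity in the Witt group W_qF: ⟨⟨f_C(e), u²v²/e²]] = ⟨1,u⟩_b ⊗ [1,r] + ⟨u, u(v+r)⟩_b ⊗ [1,v]. Consequently W_q(E/F) = ⟨1,u⟩_b ⊗ W_qF + WF ⊗ [1,v]. -/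
open QuadraticMap

variable (F : Type) [Field F]

/-- Quadratic forms on `Fin n → F`. -/
abbrev QF (n : ℕ) := QuadraticForm F (Fin n → F)

/-- The nonsingular binary quadratic form `[a,b] = a x² + x y + b y²`. -/
noncomputable def binQF (a b : F) : QF F 2 :=
  (Matrix.of ![![a, 1], ![0, b]]).toQuadraticMap'

/-- The totally singular diagonal quadratic form `⟨c₁, …, c_n⟩ = Σ cᵢ xᵢ²`. -/
noncomputable def diagQF {n : ℕ} (c : Fin n → F) : QF F n :=
  QuadraticMap.weightedSumSquares F c

/-- Orthogonal sum of a finite family of quadratic forms of the same dimension. -/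
noncomputable def oSumFam {k n : ℕ} (q : Fin k → QF F n) : QF F (k * n) :=
  (QuadraticMap.pi q).comp
    ((LinearEquiv.curry F F (Fin k) (Fin n)).toLinearMap.comp
      (LinearEquiv.funCongrLeft F F finProdFinEquiv).toLinearMap)

/-- Orthogonal sum of two quadratic forms. -/
noncomputable def oSum {n m : ℕ} (q₁ : QF F n) (q₂ : QF F m) : QF F (n + m) :=
  (QuadraticMap.prod q₁ q₂).comp
    ((LinearEquiv.sumArrowLequivProdArrow (Fin n) (Fin m) F F).toLinearMap.comp
      (LinearEquiv.funCongrLeft F F finSumFinEquiv).toLinearMap)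

section General
variable {M N : Type} [AddCommGroup M] [Module F M] [AddCommGroup N] [Module F N]

/-- Two quadratic forms are isometric if there is an isometry (isomorphism preserving the
form) between them. -/
def QIsometric (q₁ : QuadraticForm F M) (q₂ : QuadraticForm F N) : Prop :=
  Nonempty (QuadraticMap.IsometryEquiv q₁ q₂)

/-- `q₁` is dominated by `q₂` (written `q₁ ≺ q₂`) if there is an injective linear map `t`
with `q₁ x = q₂ (t x)` for all `x`. -/
def Dominates (q₁ : QuadraticForm F M) (q₂ : QuadraticForm F N) : Prop :=
  ∃ t : M →ₗ[F] N, Function.Injective t ∧ ∀ x, q₁ x = q₂ (t x)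

/-- A quadratic form is nonsingular if the radical of its polar form is trivial. -/
def Nonsingular (q : QuadraticForm F M) : Prop :=
  ∀ x, (∀ y, polar q x y = 0) → x = 0

/-- A quadratic form is totally singular if its polar form vanishes identically. -/
def TotallySingular (q : QuadraticForm F M) : Prop :=
  ∀ x y, polar q x y = 0

/-- A quadratic form is hyperbolic if it is isometric to an orthogonal sum of
hyperbolic planes `ℍ = [0,0]`. -/
def Hyperbolic (q : QuadraticForm F M) : Prop :=
  ∃ k : ℕ, QIsometric F q (oSumFam F fun _ : Fin k => binQF F 0 0)

/-- Witt equivalence: two quadratic forms are Witt equivalent iff they have isometric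
anisotropic parts, i.e. both are isometric to `i × ℍ ⊥ ρ ⊥ j × ⟨0⟩` for a common
anisotropic form `ρ`. -/
def WittEquiv (q₁ : QuadraticForm F M) (q₂ : QuadraticForm F N) : Prop :=
  ∃ (r : ℕ) (ρ : QF F r), ρ.Anisotropic ∧
    (∃ i j : ℕ, QIsometric F q₁
      (oSum F (oSum F (oSumFam F fun _ : Fin i => binQF F 0 0) ρ) (diagQF F (0 : Fin j → F)))) ∧
    (∃ i j : ℕ, QIsometric F q₂
      (oSum F (oSum F (oSumFam F fun _ : Fin i => binQF F 0 0) ρ) (diagQF F (0 : Fin j → F))))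

end General

/-- The Gram-type matrix of a quadratic form on `Fin n → F`: diagonal entries are the values
on basis vectors, above-diagonal entries the polar values. -/
noncomputable def qMat {n : ℕ} (q : QF F n) : Matrix (Fin n) (Fin n) F :=
  Matrix.of fun i j =>
    if i = j then q (Pi.single i 1)
    else if i < j then polar q (Pi.single i 1) (Pi.single j 1) else 0

/-- Scalar extension of a quadratic form along `F → E`. -/
noncomputable def extQF (E : Type) [CommRing E] [Algebra F E] {n : ℕ} (q : QF F n) :
    QuadraticForm E (Fin n → E) :=
  ((qMat F q).map (algebraMap F E)).toQuadraticMap'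

/-- Membership of the Witt class of `q` in the kernel `W_q(E/F)` of `W_qF → W_qE`:
the scalar extension of `q` is Witt equivalent to the zero form. -/
def InWqKernel (E : Type) [Field E] [Algebra F E] {n : ℕ} (q : QF F n) : Prop :=
  WittEquiv E (extQF F E q) (0 : QF E 0)

/-- The 2-fold quadratic Pfister form `⟨⟨g,h]] = ⟨1,g⟩_b ⊗ [1,h] = [1,h] ⊥ g[1,h]`. -/
noncomputable def pf2 (g h : F) : QF F 4 :=
  oSum F (binQF F 1 h) (g • binQF F 1 h)

/-- The 3-fold quadratic Pfister form `⟨⟨g₁,g₂,h]] = ⟨1,g₁⟩_b ⊗ ⟨1,g₂⟩_b ⊗ [1,h]`. -/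
noncomputable def pf3 (g₁ g₂ h : F) : QF F 8 :=
  oSum F (pf2 F g₂ h) (g₁ • pf2 F g₂ h)

/-- Orthogonal sum of a list of quadratic forms of varying dimensions. -/
noncomputable def listOSum : List (Σ n, QF F n) → Σ n, QF F n
  | [] => ⟨0, 0⟩
  | x :: L => ⟨x.1 + (listOSum L).1, oSum F x.2 (listOSum L).2⟩

/-- The cubic resolvent `f_C(X) = X³ + bX² + acX + (a²d + c²)` of
`f(X) = X⁴ + aX³ + bX² + cX + d`, evaluated at `e`. -/
def cubicResolvent (a b c d e : F) : F := e ^ 3 + b * e ^ 2 + a * c * e + (a ^ 2 * d + c ^ 2)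

namespace WittKernel

section Metabolic

variable {K : Type} [Field K]
  {V V' V₁ V₂ : Type} [AddCommGroup V] [Module K V] [AddCommGroup V'] [Module K V']
  [AddCommGroup V₁] [Module K V₁] [AddCommGroup V₂] [Module K V₂]

theorem polar_isometryEquiv {q : QuadraticForm K V} {q' : QuadraticForm K V'}
    (e : q.IsometryEquiv q') (x y : V) : polar q' (e x) (e y) = polar q x y := by
  simp only [polar, ← map_add, e.map_app]

theorem QIsometric.refl (q : QuadraticForm K V) : QIsometric K q q :=
  ⟨QuadraticMap.IsometryEquiv.refl q⟩

theorem QIsometric.symm {q : QuadraticForm K V} {q' : QuadraticForm K V'}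
    (h : QIsometric K q q') : QIsometric K q' q :=
  h.map QuadraticMap.IsometryEquiv.symm

theorem QIsometric.trans {q : QuadraticForm K V} {q' : QuadraticForm K V'}
    {q₁ : QuadraticForm K V₁} (h : QIsometric K q q') (h' : QIsometric K q' q₁) :
    QIsometric K q q₁ :=
  ⟨h.some.trans h'.some⟩

theorem QIsometric.prod {q : QuadraticForm K V} {q' : QuadraticForm K V'}
    {q₁ : QuadraticForm K V₁} {q₂ : QuadraticForm K V₂} (h : QIsometric K q q₁)
    (h' : QIsometric K q' q₂) : QIsometric K (q.prod q') (q₁.prod q₂) :=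
  ⟨h.some.prod h'.some⟩

theorem isometryEquiv_of_linearEquiv {q : QuadraticForm K V} {q' : QuadraticForm K V'}
    (e : V ≃ₗ[K] V') (h : ∀ x, q' (e x) = q x) : QIsometric K q q' :=
  ⟨⟨e, h⟩⟩

/-- A quadratic form is metabolic if it vanishes on a subspace that contains its own
orthogonal complement. -/
def Metabolic (q : QuadraticForm K V) : Prop :=
  ∃ L : Submodule K V, (∀ x ∈ L, q x = 0) ∧ ∀ x, (∀ y ∈ L, polar q x y = 0) → x ∈ L

theorem Metabolic.of_isometric {q : QuadraticForm K V} {q' : QuadraticForm K V'}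
    (h : Metabolic q) (e : QIsometric K q q') : Metabolic q' := by
  obtain ⟨L, h₁, h₂⟩ := h
  obtain ⟨e⟩ := e
  refine ⟨L.comap e.symm.toLinearEquiv.toLinearMap, fun x hx => ?_, fun x hx => ?_⟩
  · rw [← h₁ _ hx]
    exact (e.symm.map_app x).symm
  · refine h₂ _ fun y hy => ?_
    have := hx (e y) (by
      change e.symm (e y) ∈ L
      simpa using hy)
    rw [← this, ← polar_isometryEquiv e.symm]
    change polar q (e.symm x) y = polar q (e.symm x) (e.symm (e y))
    simp

theorem Metabolic.prod {q : QuadraticForm K V} {q' : QuadraticForm K V'}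
    (h : Metabolic q) (h' : Metabolic q') : Metabolic (q.prod q') := by
  obtain ⟨L, h₁, h₂⟩ := h
  obtain ⟨L', h₁', h₂'⟩ := h'
  refine ⟨L.prod L', fun x hx => by simp [h₁ _ hx.1, h₁' _ hx.2], fun x hx => ⟨?_, ?_⟩⟩
  · exact h₂ _ fun y hy => by simpa using hx (y, 0) ⟨hy, L'.zero_mem⟩
  · exact h₂' _ fun y hy => by simpa using hx (0, y) ⟨L.zero_mem, hy⟩

theorem nonsingular_of_subsingleton [Subsingleton V] (q : QuadraticForm K V) :
    Nonsingular K q :=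
  fun _ _ => Subsingleton.elim _ _

theorem metabolic_of_subsingleton [Subsingleton V] (q : QuadraticForm K V) : Metabolic q :=
  ⟨⊤, fun x _ => by rw [Subsingleton.elim x 0, map_zero], fun _ _ => trivial⟩

theorem metabolic_zero : Metabolic (0 : QuadraticForm K V) :=
  ⟨⊤, fun _ _ => rfl, fun _ _ => trivial⟩

theorem nonsingular_prod {q : QuadraticForm K V} {q' : QuadraticForm K V'}
    (h : Nonsingular K q) (h' : Nonsingular K q') : Nonsingular K (q.prod q') := by
  intro x hx
  refine Prod.ext (h _ fun y => ?_) (h' _ fun y => ?_)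
  · simpa using hx (y, 0)
  · simpa using hx (0, y)

theorem nonsingular_of_isometric {q : QuadraticForm K V} {q' : QuadraticForm K V'}
    (h : Nonsingular K q) (e : QIsometric K q q') : Nonsingular K q' := by
  obtain ⟨e⟩ := e
  intro x hx
  have : e.symm x = 0 := h _ fun y => by
    rw [← polar_isometryEquiv e]
    simpa using hx (e y)
  have h2 := congrArg e this
  simpa using h2

theorem nonsingular_of_prod_right {q : QuadraticForm K V} {q' : QuadraticForm K V'}
    (h : Nonsingular K (q.prod q')) : Nonsingular K q' := by
  intro x hx
  have := h (0, x) fun y => by simp [hx]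
  exact congrArg Prod.snd this

theorem polarBilin_isRefl (q : QuadraticForm K V) : (polarBilin q).IsRefl := by
  intro x y h
  rw [← h]
  exact polar_comm q y x

theorem nondegenerate_polarBilin {q : QuadraticForm K V} (h : Nonsingular K q) :
    (polarBilin q).Nondegenerate :=
  (polarBilin_isRefl q).nondegenerate_iff_separatingLeft.2 fun x hx => h x fun y => hx y

theorem mem_orthogonal {q : QuadraticForm K V} {L : Submodule K V} {x : V} :
    x ∈ LinearMap.BilinForm.orthogonal (polarBilin q) L ↔ ∀ y ∈ L, polar q x y = 0 := by
  rw [LinearMap.BilinForm.mem_orthogonal_iff]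
  refine forall₂_congr fun y _ => ?_
  rw [polar_comm]
  rfl

theorem Metabolic.cancel_right [FiniteDimensional K V] [FiniteDimensional K V']
    {q : QuadraticForm K V} {q' : QuadraticForm K V'}
    (h : Metabolic (q.prod q')) (h' : Metabolic q') (hn : Nonsingular K (q.prod q')) :
    Metabolic q := by
  obtain ⟨L, h₁, h₂⟩ := h
  obtain ⟨M, h₁', h₂'⟩ := h'
  refine ⟨(L ⊓ (⊤ : Submodule K V).prod M).map (LinearMap.fst K V V'), ?_, fun a ha => ?_⟩
  · rintro _ ⟨⟨x, m⟩, ⟨hx, -, hm⟩, rfl⟩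
    have h₃ := h₁ _ hx
    rw [QuadraticMap.prod_apply, h₁' _ hm, add_zero] at h₃
    exact h₃
  · have key : (a, (0 : V')) ∈ L ⊔ (⊥ : Submodule K V).prod M := by
      rw [← LinearMap.BilinForm.orthogonal_orthogonal (nondegenerate_polarBilin hn) (polarBilin_isRefl _)
        (L ⊔ (⊥ : Submodule K V).prod M), mem_orthogonal]
      rintro ⟨n₁, n₂⟩ hn'
      rw [mem_orthogonal] at hn'
      have hL : (n₁, n₂) ∈ L := h₂ _ fun y hy => hn' y (Submodule.mem_sup_left hy)
      have hM : n₂ ∈ M := h₂' _ fun y hy => by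
        simpa using hn' (0, y) (Submodule.mem_sup_right ⟨rfl, hy⟩)
      simpa using ha n₁ ⟨(n₁, n₂), ⟨hL, trivial, hM⟩, rfl⟩
    obtain ⟨l, hl, ⟨z, m⟩, ⟨hz, hm⟩, hlm⟩ := Submodule.mem_sup.1 key
    have hz' : z = 0 := hz
    subst hz'
    refine ⟨l, ⟨hl, trivial, ?_⟩, ?_⟩
    · have : l.2 = -m := eq_neg_of_add_eq_zero_left (congrArg Prod.snd hlm)
      rw [this]
      exact M.neg_mem hm
    · simpa using congrArg Prod.fst hlm

theorem metabolic_prod_of_isometric [CharP K 2] {q : QuadraticForm K V}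
    {q' : QuadraticForm K V'} (hn : Nonsingular K q') (e : QIsometric K q q') :
    Metabolic (q.prod q') := by
  obtain ⟨e⟩ := e
  refine ⟨LinearMap.graph e.toLinearEquiv.toLinearMap, ?_, ?_⟩
  · rintro ⟨x, y⟩ hxy
    rw [LinearMap.mem_graph_iff] at hxy
    dsimp only at hxy
    subst hxy
    simpa using (congrArg (q x + ·) (e.map_app x)).trans (CharTwo.add_self_eq_zero (q x))
  · rintro ⟨x, y⟩ h
    rw [LinearMap.mem_graph_iff]
    change y = e x
    rw [← sub_eq_zero]
    refine hn _ fun z => ?_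
    have h₃ := h (e.symm z, z) (by
      rw [LinearMap.mem_graph_iff]
      exact (e.apply_symm_apply z).symm)
    rw [polar_prod, ← polar_isometryEquiv e] at h₃
    rw [polar_sub_left, CharTwo.sub_eq_add, add_comm]
    simpa using h₃

theorem Metabolic.two_mul_finrank [FiniteDimensional K V] {q : QuadraticForm K V}
    (hn : Nonsingular K q) (h : Metabolic q) :
    ∃ L : Submodule K V, (∀ x ∈ L, q x = 0) ∧ 2 * Module.finrank K L = Module.finrank K V := by
  obtain ⟨L, h₁, h₂⟩ := h
  refine ⟨L, h₁, ?_⟩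
  have hL : LinearMap.BilinForm.orthogonal (polarBilin q) L = L := by
    refine le_antisymm (fun x hx => h₂ x (mem_orthogonal.1 hx)) fun x hx => ?_
    refine mem_orthogonal.2 fun y hy => ?_
    simp [polar, h₁ _ hx, h₁ _ hy, h₁ _ (L.add_mem hx hy)]
  have := LinearMap.BilinForm.finrank_orthogonal (nondegenerate_polarBilin hn) L
  have h₃ := L.finrank_le
  rw [hL] at this
  lia

end Metabolic

section WittGroup

/-- A finite-dimensional vector space with a nonsingular quadratic form. -/
structure QuadSpace (K : Type) [Field K] : Type 1 where
  carrier : Type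
  [addCommGroup : AddCommGroup carrier]
  [module : Module K carrier]
  [finiteDimensional : FiniteDimensional K carrier]
  form : QuadraticForm K carrier
  nonsingular : Nonsingular K form

attribute [instance] QuadSpace.addCommGroup QuadSpace.module QuadSpace.finiteDimensional

variable {K : Type} [Field K] [CharP K 2]

theorem metabolic_prod_trans {A B C : QuadSpace K} (h : Metabolic (A.form.prod B.form))
    (h' : Metabolic (B.form.prod C.form)) : Metabolic (A.form.prod C.form) := by
  refine Metabolic.cancel_right (q' := B.form.prod B.form) ?_
    (metabolic_prod_of_isometric B.nonsingular (QIsometric.refl _))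
    (nonsingular_prod (nonsingular_prod A.nonsingular C.nonsingular)
      (nonsingular_prod B.nonsingular B.nonsingular))
  have h₃ : Metabolic (C.form.prod B.form) := h'.of_isometric ⟨IsometryEquiv.prodComm _ _⟩
  exact (h.prod h₃).of_isometric ⟨IsometryEquiv.prodProdProdComm _ _ _ _⟩

variable (K) in
/-- Witt equivalence of nonsingular quadratic spaces. -/
instance wittSetoid : Setoid (QuadSpace K) where
  r A B := Metabolic (A.form.prod B.form)
  iseqv :=
    { refl := fun A => metabolic_prod_of_isometric A.nonsingular (QIsometric.refl _)
      symm := fun h => h.of_isometric ⟨IsometryEquiv.prodComm _ _⟩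
      trans := metabolic_prod_trans }

variable (K) in
/-- The Witt group of nonsingular quadratic forms in characteristic two. -/
def WittGroup : Type 1 := Quotient (wittSetoid K)

/-- The orthogonal sum of two nonsingular quadratic spaces. -/
def QuadSpace.sum (A B : QuadSpace K) : QuadSpace K :=
  ⟨A.carrier × B.carrier, A.form.prod B.form, nonsingular_prod A.nonsingular B.nonsingular⟩

/-- The zero quadratic space. -/
def QuadSpace.zero : QuadSpace K := ⟨PUnit, 0, nonsingular_of_subsingleton _⟩

variable {V V' : Type} [AddCommGroup V] [Module K V] [AddCommGroup V'] [Module K V']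
  [FiniteDimensional K V] [FiniteDimensional K V']

/-- The Witt class of a nonsingular quadratic form. -/
def cl (q : QuadraticForm K V) (hq : Nonsingular K q) : WittGroup K :=
  Quotient.mk (wittSetoid K) ⟨V, q, hq⟩

theorem cl_eq_iff {q : QuadraticForm K V} {q' : QuadraticForm K V'} {hq : Nonsingular K q}
    {hq' : Nonsingular K q'} : cl q hq = cl q' hq' ↔ Metabolic (q.prod q') :=
  ⟨fun h => Quotient.exact h, fun h => Quotient.sound h⟩

theorem cl_eq_of_isometric {q : QuadraticForm K V} {q' : QuadraticForm K V'}
    {hq : Nonsingular K q} {hq' : Nonsingular K q'} (e : QIsometric K q q') :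
    cl q hq = cl q' hq' :=
  cl_eq_iff.2 (metabolic_prod_of_isometric hq' e)

instance : Zero (WittGroup K) := ⟨Quotient.mk _ QuadSpace.zero⟩

instance : Add (WittGroup K) where
  add := Quotient.map₂ QuadSpace.sum fun _ _ h _ _ h' =>
    (Metabolic.prod h h').of_isometric ⟨QuadraticMap.IsometryEquiv.prodProdProdComm _ _ _ _⟩

instance : Neg (WittGroup K) := ⟨id⟩

theorem cl_prod {q : QuadraticForm K V} {q' : QuadraticForm K V'} (hq : Nonsingular K q)
    (hq' : Nonsingular K q') :
    cl (q.prod q') (nonsingular_prod hq hq') = cl q hq + cl q' hq' :=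
  rfl

theorem cl_zero :
    cl (0 : QuadraticForm K PUnit) (nonsingular_of_subsingleton _) = 0 := rfl

theorem WittGroup.ind {P : WittGroup K → Prop}
    (h : ∀ (V : Type) [AddCommGroup V] [Module K V] [FiniteDimensional K V]
      (q : QuadraticForm K V) (hq : Nonsingular K q), P (cl q hq)) (w : WittGroup K) : P w :=
  Quotient.ind (fun A => h A.carrier A.form A.nonsingular) w

theorem cl_eq_zero_iff {q : QuadraticForm K V} {hq : Nonsingular K q} :
    cl q hq = 0 ↔ Metabolic q := by
  rw [← cl_zero, cl_eq_iff]
  have e : QIsometric K (q.prod (0 : QuadraticForm K PUnit)) q :=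
    isometryEquiv_of_linearEquiv LinearEquiv.prodUnique fun x => by simp
  exact ⟨fun h => h.of_isometric e, fun h => h.of_isometric ⟨e.some.symm⟩⟩

instance : AddCommGroup (WittGroup K) where
  add_assoc a b c := by
    induction a using WittGroup.ind with | h V q hq => ?_
    induction b using WittGroup.ind with | h V' q' hq' => ?_
    induction c using WittGroup.ind with | h V'' q'' hq'' => ?_
    rw [← cl_prod, ← cl_prod, ← cl_prod, ← cl_prod]
    exact cl_eq_of_isometric
      (isometryEquiv_of_linearEquiv (LinearEquiv.prodAssoc K V V' V'') fun x => by
        simp [add_assoc])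
  zero_add a := by
    induction a using WittGroup.ind with | h V q hq => ?_
    rw [← cl_zero, ← cl_prod]
    exact cl_eq_of_isometric (isometryEquiv_of_linearEquiv LinearEquiv.uniqueProd fun x => by
      simp)
  add_zero a := by
    induction a using WittGroup.ind with | h V q hq => ?_
    rw [← cl_zero, ← cl_prod]
    exact cl_eq_of_isometric (isometryEquiv_of_linearEquiv LinearEquiv.prodUnique fun x => by
      simp)
  add_comm a b := by
    induction a using WittGroup.ind with | h V q hq => ?_
    induction b using WittGroup.ind with | h V' q' hq' => ?_
    rw [← cl_prod, ← cl_prod]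
    exact cl_eq_of_isometric ⟨IsometryEquiv.prodComm _ _⟩
  neg_add_cancel a := by
    induction a using WittGroup.ind with | h V q hq => ?_
    change cl q hq + cl q hq = 0
    rw [← cl_prod, cl_eq_zero_iff]
    exact metabolic_prod_of_isometric hq (QIsometric.refl _)
  nsmul := nsmulRec
  zsmul := zsmulRec

theorem WittGroup.neg_eq (a : WittGroup K) : -a = a := rfl

theorem WittGroup.add_self (a : WittGroup K) : a + a = 0 := neg_add_cancel a

end WittGroup

section Binary

variable {K : Type} [Field K]

@[simp]
theorem binQF_apply (a b : K) (x : Fin 2 → K) :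
    binQF K a b x = a * x 0 ^ 2 + x 0 * x 1 + b * x 1 ^ 2 := by
  change (!![a, 1; 0, b] : Matrix (Fin 2) (Fin 2) K).toQuadraticForm' x = _
  simp [Matrix.toQuadraticForm', LinearMap.BilinMap.toQuadraticMap_apply,
    Matrix.toLinearMap₂'_apply, Fin.sum_univ_two]
  ring

variable [CharP K 2]

@[simp]
theorem polar_binQF (a b : K) (x y : Fin 2 → K) :
    polar (binQF K a b) x y = x 0 * y 1 + x 1 * y 0 := by
  simp only [polar, binQF_apply, Pi.add_apply]
  linear_combination (a * x 0 * y 0 + b * x 1 * y 1) * CharTwo.two_eq_zero (R := K)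

theorem nonsingular_binQF (a b : K) : Nonsingular K (binQF K a b) := by
  intro x hx
  ext i
  fin_cases i
  · simpa using hx ![0, 1]
  · simpa using hx ![1, 0]

/-- The Witt class of the binary form `[a,b]`. -/
noncomputable def binCl (a b : K) : WittGroup K := cl (binQF K a b) (nonsingular_binQF a b)

theorem binCl_add (a b b' : K) : binCl a b + binCl a b' = binCl a (b + b') := by
  rw [binCl, binCl, binCl, ← cl_prod, cl_eq_iff]
  have h2 : (2 : K) = 0 := CharTwo.two_eq_zero
  refine ⟨{ carrier := {z | z.1.1 1 = z.2 1 ∧ z.1.2 1 = z.2 1 ∧ z.1.1 0 + z.1.2 0 + z.2 0 = 0}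
            add_mem' := ?_, zero_mem' := by simp, smul_mem' := ?_ }, ?_, ?_⟩
  · rintro x y ⟨h₁, h₂, h₃⟩ ⟨h₁', h₂', h₃'⟩
    simp only [Set.mem_ofPred_eq, Prod.fst_add, Prod.snd_add, Pi.add_apply]
    exact ⟨by rw [h₁, h₁'], by rw [h₂, h₂'], by linear_combination h₃ + h₃'⟩
  · rintro c x ⟨h₁, h₂, h₃⟩
    simp only [Set.mem_ofPred_eq, Prod.smul_fst, Prod.smul_snd, Pi.smul_apply, smul_eq_mul]
    exact ⟨by rw [h₁], by rw [h₂], by linear_combination c * h₃⟩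
  · rintro x ⟨h₁, h₂, h₃⟩
    simp only [QuadraticMap.prod_apply, binQF_apply]
    rw [h₁, h₂]
    linear_combination (a * (x.1.1 0 + x.1.2 0 + x.2 0) + x.2 1) * h₃
      + ((b + b') * x.2 1 ^ 2 - a * (x.1.1 0 * x.1.2 0 + x.1.1 0 * x.2 0 + x.1.2 0 * x.2 0)) * h2
  · rintro x hx
    have e₁ := hx ((![1, 0], ![1, 0]), 0) (by
      change _ ∧ _ ∧ _
      simp [CharTwo.add_self_eq_zero])
    have e₂ := hx ((![1, 0], 0), ![1, 0]) (by
      change _ ∧ _ ∧ _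
      simp [CharTwo.add_self_eq_zero])
    have e₃ := hx ((![0, 1], ![0, 1]), ![0, 1]) (by
      change _ ∧ _ ∧ _
      simp)
    simp at e₁ e₂ e₃
    change _ ∧ _ ∧ _
    exact ⟨by linear_combination e₂ - x.2 1 * h2,
      by linear_combination e₁ - e₂ + (x.2 1 - x.2 1 ) * h2 , by linear_combination e₃⟩

theorem binCl_eq_zero {a b : K} (s : K) (h : a * s ^ 2 + s + b = 0) : binCl a b = 0 := by
  rw [binCl, cl_eq_zero_iff]
  refine ⟨{ carrier := {z | z 0 = s * z 1}, add_mem' := ?_, zero_mem' := by simp,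
            smul_mem' := ?_ }, ?_, ?_⟩
  · intro x y h₁ h₂
    simp only [Set.mem_ofPred_eq, Pi.add_apply] at *
    rw [h₁, h₂, mul_add]
  · intro c x h₁
    simp only [Set.mem_ofPred_eq, Pi.smul_apply, smul_eq_mul] at *
    rw [h₁]
    ring
  · intro x hx
    change x 0 = s * x 1 at hx
    rw [binQF_apply, hx]
    linear_combination x 1 ^ 2 * h
  · intro x hx
    have := hx ![s, 1] (by
      change _ = _
      simp)
    simp at this
    change x 0 = s * x 1
    linear_combination this - s * x 1 * CharTwo.two_eq_zero (R := K)

end Binary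

section Split

variable {K : Type} [Field K] {V : Type} [AddCommGroup V] [Module K V]

/-- The orthogonal complement of two vectors. -/
def perp (q : QuadraticForm K V) (x y : V) : Submodule K V :=
  LinearMap.ker (polarBilin q x) ⊓ LinearMap.ker (polarBilin q y)

/-- The restriction of a quadratic form to the orthogonal complement of two vectors. -/
def perpForm (q : QuadraticForm K V) (x y : V) : QuadraticForm K (perp q x y) :=
  q.comp (perp q x y).subtype

theorem mem_perp {q : QuadraticForm K V} {x y z : V} :
    z ∈ perp q x y ↔ polar q x z = 0 ∧ polar q y z = 0 := Iff.rfl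

theorem exists_polar_eq_one {q : QuadraticForm K V} (hq : Nonsingular K q) {x : V}
    (hx : x ≠ 0) : ∃ y, polar q x y = 1 := by
  by_contra! h
  refine hx (hq x fun y => ?_)
  by_contra hy
  refine h ((polar q x y)⁻¹ • y) ?_
  rw [polar_smul_right, smul_eq_mul, inv_mul_cancel₀ hy]

theorem exists_polar_eq_one_and_eq_zero {q : QuadraticForm K V} (hq : Nonsingular K q) {y w : V}
    (hw : w ≠ 0) (h : ∀ t : K, y ≠ t • w) : ∃ z, polar q y z = 1 ∧ polar q w z = 0 := by
  by_contra! hz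
  have hz' : ∀ z, polar q w z = 0 → polar q y z = 0 := by
    intro z hwz
    by_contra hyz
    refine hz ((polar q y z)⁻¹ • z) ?_ ?_
    · rw [polar_smul_right, smul_eq_mul, inv_mul_cancel₀ hyz]
    · rw [polar_smul_right, hwz, smul_zero]
  obtain ⟨w', hw'⟩ := exists_polar_eq_one hq hw
  refine h (polar q y w') (sub_eq_zero.1 (hq _ fun z => ?_))
  have := hz' (z - polar q w z • w') (by
    rw [polar_sub_right, polar_smul_right, hw', smul_eq_mul, mul_one, sub_self])
  rw [polar_sub_right, polar_smul_right, smul_eq_mul] at this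
  rw [polar_sub_left, polar_smul_left, smul_eq_mul]
  linear_combination this

theorem nonsingular_smul {q : QuadraticForm K V} (hq : Nonsingular K q) {c : K} (hc : c ≠ 0) :
    Nonsingular K (c • q) := by
  intro x hx
  refine hq x fun y => ?_
  have := hx y
  rw [FunLike.coe_smul, polar_smul, smul_eq_mul, mul_eq_zero] at this
  exact this.resolve_left hc

variable [CharP K 2]

theorem isometric_split (q : QuadraticForm K V) {x y : V} (h : polar q x y = 1) :
    QIsometric K ((binQF K (q x) (q y)).prod (perpForm q x y)) q := by
  have h' : polar q y x = 1 := by rw [polar_comm, h]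
  let f : (Fin 2 → K) × perp q x y →ₗ[K] V :=
    { toFun := fun z => z.1 0 • x + z.1 1 • y + z.2
      map_add' := fun a b => by
        simp only [Prod.fst_add, Prod.snd_add, Pi.add_apply, add_smul, Submodule.coe_add]
        abel
      map_smul' := fun c a => by
        simp [mul_smul, smul_add] }
  have hpx : ∀ z, polar q x (f z) = z.1 1 := fun z => by
    simp [f, polar_add_right, polar_smul_right, CharTwo.two_eq_zero, h, (mem_perp.1 z.2.2).1]
  have hpy : ∀ z, polar q y (f z) = z.1 0 := fun z => by
    simp [f, polar_add_right, polar_smul_right, CharTwo.two_eq_zero, h', (mem_perp.1 z.2.2).2]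
  have hf : Function.Bijective f := by
    constructor
    · rw [← LinearMap.ker_eq_bot, LinearMap.ker_eq_bot']
      intro z hz
      have h₀ : z.1 0 = 0 := by rw [← hpy, hz]; simp
      have h₁ : z.1 1 = 0 := by rw [← hpx, hz]; simp
      refine Prod.ext ?_ (Subtype.ext ?_)
      · ext i
        fin_cases i
        · exact h₀
        · exact h₁
      · simpa [f, h₀, h₁] using hz
    · intro z
      refine ⟨(![polar q y z, polar q x z],
        ⟨z - polar q y z • x - polar q x z • y, mem_perp.2 ⟨?_, ?_⟩⟩), ?_⟩
      · simp [polar_sub_right, polar_smul_right, CharTwo.two_eq_zero, h]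
      · simp [polar_sub_right, polar_smul_right, CharTwo.two_eq_zero, h']
      · simp [f]
  refine isometryEquiv_of_linearEquiv (LinearEquiv.ofBijective f hf) fun z => ?_
  obtain ⟨h₁, h₂⟩ := mem_perp.1 z.2.2
  rw [LinearEquiv.ofBijective_apply]
  simp only [f, LinearMap.coe_mk, AddHom.coe_mk, QuadraticMap.prod_apply, binQF_apply, perpForm,
    QuadraticMap.comp_apply, Submodule.subtype_apply]
  rw [QuadraticMap.map_add q, QuadraticMap.map_add q (z.1 0 • x), polar_add_left]
  simp only [polar_smul_left, polar_smul_right, QuadraticMap.map_smul, h, h₁, h₂, smul_eq_mul]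
  ring

theorem nonsingular_perpForm {q : QuadraticForm K V} (hq : Nonsingular K q) {x y : V}
    (h : polar q x y = 1) : Nonsingular K (perpForm q x y) :=
  nonsingular_of_prod_right (nonsingular_of_isometric hq (QIsometric.symm (isometric_split q h)))

theorem finrank_perp [FiniteDimensional K V] (q : QuadraticForm K V) {x y : V}
    (h : polar q x y = 1) :
    Module.finrank K V = 2 + Module.finrank K (perp q x y) := by
  rw [← (isometric_split q h).some.toLinearEquiv.finrank_eq, Module.finrank_prod]
  simp

theorem cl_split [FiniteDimensional K V] {q : QuadraticForm K V} (hq : Nonsingular K q) {x y : V}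
    (h : polar q x y = 1) :
    cl q hq = binCl (q x) (q y) + cl (perpForm q x y) (nonsingular_perpForm hq h) := by
  rw [binCl, ← cl_prod]
  exact (cl_eq_of_isometric (isometric_split q h)).symm

theorem cl_eq_binCl [FiniteDimensional K V] {q : QuadraticForm K V} (hq : Nonsingular K q)
    {x y : V} (h : polar q x y = 1) (hV : Module.finrank K V = 2) :
    cl q hq = binCl (q x) (q y) := by
  rw [cl_split hq h, add_eq_left, cl_eq_zero_iff]
  have : Module.finrank K (perp q x y) = 0 := by
    have := finrank_perp q h
    lia
  have := Module.finrank_zero_iff.1 this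
  exact metabolic_of_subsingleton _

theorem binCl_comm (a b : K) : binCl a b = binCl b a := by
  rw [binCl, cl_eq_binCl (x := ![0, 1]) (y := ![1, 0]) (nonsingular_binQF a b) (by simp) (by simp)]
  simp

theorem binCl_scale (a b : K) {c : K} (hc : c ≠ 0) :
    binCl (a * c ^ 2) (b / c ^ 2) = binCl a b := by
  symm
  rw [binCl, cl_eq_binCl (x := ![c, 0]) (y := ![0, c⁻¹]) (nonsingular_binQF a b)
    (by simp [hc]) (by simp)]
  simp [div_eq_mul_inv]

theorem cl_smul_binQF (a b : K) {c : K} (hc : c ≠ 0) :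
    cl (c • binQF K a b) (nonsingular_smul (nonsingular_binQF a b) hc) =
      binCl (c * a) (b / c) := by
  rw [cl_eq_binCl (x := ![1, 0]) (y := ![0, c⁻¹]) _ (by
    rw [FunLike.coe_smul, polar_smul, polar_binQF]; simp [hc]) (by simp)]
  congr 1
  · simp
  · simp
    field_simp

theorem binCl_sq_right {a : K} (ha : a ≠ 0) (t : K) : binCl a (t ^ 2 / a) = binCl a (t / a) := by
  rw [← sub_eq_zero, sub_eq_add_neg, WittGroup.neg_eq, binCl_add]
  refine binCl_eq_zero (t / a) ?_
  field_simp
  linear_combination (t ^ 2 + t) * CharTwo.two_eq_zero (R := K)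

end Split

section Sums

variable {K : Type} [Field K] {V V' : Type} [AddCommGroup V] [Module K V]
  [AddCommGroup V'] [Module K V']

theorem isometric_prodComm (q : QuadraticForm K V) (q' : QuadraticForm K V') :
    QIsometric K (q.prod q') (q'.prod q) :=
  ⟨IsometryEquiv.prodComm q q'⟩

theorem isometric_prodAssoc {V₁ : Type} [AddCommGroup V₁] [Module K V₁] (q : QuadraticForm K V)
    (q' : QuadraticForm K V') (q₁ : QuadraticForm K V₁) :
    QIsometric K ((q.prod q').prod q₁) (q.prod (q'.prod q₁)) :=
  isometryEquiv_of_linearEquiv (LinearEquiv.prodAssoc K V V' V₁) fun x => by simp [add_assoc]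

theorem isometric_prodProdProdComm {V₁ V₂ : Type} [AddCommGroup V₁] [Module K V₁]
    [AddCommGroup V₂] [Module K V₂] (q : QuadraticForm K V) (q' : QuadraticForm K V')
    (q₁ : QuadraticForm K V₁) (q₂ : QuadraticForm K V₂) :
    QIsometric K ((q.prod q').prod (q₁.prod q₂)) ((q.prod q₁).prod (q'.prod q₂)) :=
  ⟨IsometryEquiv.prodProdProdComm q q' q₁ q₂⟩

theorem isometric_uniqueProd [Subsingleton V] (q : QuadraticForm K V) (q' : QuadraticForm K V') :
    QIsometric K (q.prod q') q' :=
  haveI := uniqueOfSubsingleton (0 : V)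
  isometryEquiv_of_linearEquiv LinearEquiv.uniqueProd fun x => by
    rw [QuadraticMap.prod_apply, Subsingleton.elim x.1 0, map_zero, zero_add]
    rfl

theorem isometric_prodUnique [Subsingleton V'] (q : QuadraticForm K V) (q' : QuadraticForm K V') :
    QIsometric K (q.prod q') q :=
  QIsometric.trans (isometric_prodComm q q') (isometric_uniqueProd q' q)

theorem isometric_oSum {n m : ℕ} (q₁ : QF K n) (q₂ : QF K m) :
    QIsometric K (oSum K q₁ q₂) (q₁.prod q₂) :=
  isometryEquiv_of_linearEquiv
    ((LinearEquiv.funCongrLeft K K finSumFinEquiv).trans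
      (LinearEquiv.sumArrowLequivProdArrow (Fin n) (Fin m) K K)) fun _ => rfl

theorem isometric_oSumFam {k n : ℕ} (q : Fin k → QF K n) :
    QIsometric K (oSumFam K q) (QuadraticMap.pi q) :=
  isometryEquiv_of_linearEquiv
    ((LinearEquiv.funCongrLeft K K finProdFinEquiv).trans
      (LinearEquiv.curry K K (Fin k) (Fin n))) fun _ => rfl

theorem isometric_pi_succ {n : ℕ} (q : Fin (n + 1) → QuadraticForm K V) :
    QIsometric K ((q 0).prod (QuadraticMap.pi fun i : Fin n => q i.succ))
      (QuadraticMap.pi q) :=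
  isometryEquiv_of_linearEquiv (Fin.consLinearEquiv K fun _ => V) fun x => by
    simp [Fin.sum_univ_succ, Fin.consLinearEquiv]

theorem nonsingular_pi {ι : Type} [Fintype ι] [DecidableEq ι] {q : ι → QuadraticForm K V}
    (hq : ∀ i, Nonsingular K (q i)) : Nonsingular K (QuadraticMap.pi q) := by
  intro x hx
  funext i
  refine hq i _ fun y => ?_
  have := hx (Pi.single i y)
  rw [QuadraticMap.Ring.polar_pi, Finset.sum_eq_single i] at this
  · simpa using this
  · intro j _ hj
    simp [Pi.single_eq_of_ne hj]
  · simp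

theorem isometric_fin [FiniteDimensional K V] (q : QuadraticForm K V) :
    ∃ q' : QF K (Module.finrank K V), QIsometric K q q' :=
  ⟨q.comp (Module.finBasis K V).equivFun.symm.toLinearMap,
    isometryEquiv_of_linearEquiv (Module.finBasis K V).equivFun fun x => by simp⟩

theorem metabolic_pi {ι : Type} [Fintype ι] [DecidableEq ι] {q : ι → QuadraticForm K V}
    (hq : ∀ i, Metabolic (q i)) : Metabolic (QuadraticMap.pi q) := by
  choose L h₁ h₂ using hq
  refine ⟨Submodule.pi Set.univ L, fun x hx => ?_, fun x hx i _ => ?_⟩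
  · rw [QuadraticMap.pi_apply]
    exact Finset.sum_eq_zero fun i _ => h₁ i _ (hx i trivial)
  · refine h₂ i _ fun y hy => ?_
    have := hx (Pi.single i y) fun j _ => by
      by_cases hj : j = i
      · subst hj
        simpa using hy
      · simp [Pi.single_eq_of_ne hj]
    rw [QuadraticMap.Ring.polar_pi, Finset.sum_eq_single i] at this
    · simpa using this
    · intro j _ hj
      simp [Pi.single_eq_of_ne hj]
    · simp

theorem nonsingular_oSum {n m : ℕ} {q₁ : QF K n} {q₂ : QF K m} (h₁ : Nonsingular K q₁)
    (h₂ : Nonsingular K q₂) : Nonsingular K (oSum K q₁ q₂) :=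
  nonsingular_of_isometric (nonsingular_prod h₁ h₂) (QIsometric.symm (isometric_oSum q₁ q₂))

theorem nonsingular_oSumFam {k n : ℕ} {q : Fin k → QF K n} (h : ∀ i, Nonsingular K (q i)) :
    Nonsingular K (oSumFam K q) :=
  nonsingular_of_isometric (nonsingular_pi h) (QIsometric.symm (isometric_oSumFam q))

theorem isometric_witt_sum (i : ℕ) {r : ℕ} (ρ : QF K r) :
    QIsometric K (oSum K (oSum K (oSumFam K fun _ : Fin i => binQF K 0 0) ρ)
      (diagQF K (0 : Fin 0 → K))) ((QuadraticMap.pi fun _ : Fin i => binQF K 0 0).prod ρ) :=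
  QIsometric.trans (isometric_oSum _ _) (QIsometric.trans (isometric_prodUnique _ _)
    (QIsometric.trans (isometric_oSum _ _) (QIsometric.prod (isometric_oSumFam _)
      (QIsometric.refl ρ))))

theorem nonsingular_of_witt_decomposition {q : QuadraticForm K V} {i j r : ℕ} {ρ : QF K r}
    (hq : Nonsingular K q)
    (e : QIsometric K q (oSum K (oSum K (oSumFam K fun _ : Fin i => binQF K 0 0) ρ)
        (diagQF K (0 : Fin j → K)))) : Nonsingular K ρ := by
  have h := nonsingular_of_isometric hq (QIsometric.trans (QIsometric.trans e
    (isometric_oSum _ _)) (isometric_prodComm _ _))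
  exact nonsingular_of_prod_right (nonsingular_of_isometric (nonsingular_of_prod_right h)
    (isometric_oSum _ _))

variable [CharP K 2]

theorem cl_pi [FiniteDimensional K V] {n : ℕ} {q : Fin n → QuadraticForm K V}
    (hq : ∀ i, Nonsingular K (q i)) :
    cl (QuadraticMap.pi q) (nonsingular_pi hq) = ∑ i, cl (q i) (hq i) := by
  induction n with
  | zero => exact cl_eq_zero_iff.2 (metabolic_of_subsingleton _)
  | succ n ih =>
    rw [Fin.sum_univ_succ, ← ih fun i => hq i.succ, ← cl_prod]
    exact (cl_eq_of_isometric (isometric_pi_succ q)).symm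

theorem cl_oSum {n m : ℕ} {q₁ : QF K n} {q₂ : QF K m} (h₁ : Nonsingular K q₁)
    (h₂ : Nonsingular K q₂) : cl (oSum K q₁ q₂) (nonsingular_oSum h₁ h₂) = cl q₁ h₁ + cl q₂ h₂ :=
  cl_eq_of_isometric (isometric_oSum q₁ q₂)

theorem cl_oSumFam {k n : ℕ} {q : Fin k → QF K n} (h : ∀ i, Nonsingular K (q i)) :
    cl (oSumFam K q) (nonsingular_oSumFam h) = ∑ i, cl (q i) (h i) := by
  rw [← cl_pi]
  exact cl_eq_of_isometric (isometric_oSumFam q)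

end Sums

section WittDecomposition

variable {K : Type} [Field K] [CharP K 2] {V V' : Type} [AddCommGroup V] [Module K V]
  [AddCommGroup V'] [Module K V']

theorem metabolic_binQF_zero : Metabolic (binQF K 0 0) :=
  cl_eq_zero_iff.1 (binCl_eq_zero (0 : K) (by simp))

theorem metabolic_hyperbolic (i : ℕ) :
    Metabolic (oSumFam K fun _ : Fin i => binQF K 0 0) :=
  (metabolic_pi fun _ => metabolic_binQF_zero).of_isometric
    (QIsometric.symm (isometric_oSumFam _))

theorem exists_hyperbolic_pair {q : QuadraticForm K V} (hq : Nonsingular K q) {x : V}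
    (hx : x ≠ 0) (h : q x = 0) : ∃ y, polar q x y = 1 ∧ q y = 0 := by
  obtain ⟨y, hy⟩ := exists_polar_eq_one hq hx
  refine ⟨y + q y • x, ?_, ?_⟩
  · rw [polar_add_right, polar_smul_right, polar_self, h, hy]
    simp
  · rw [QuadraticMap.map_add q, polar_smul_right, polar_comm, hy, QuadraticMap.map_smul, h]
    simp [CharTwo.add_self_eq_zero]

theorem exists_witt_decomposition_pi (n : ℕ) : ∀ {V : Type} [AddCommGroup V] [Module K V]
    [FiniteDimensional K V] (q : QuadraticForm K V), Nonsingular K q →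
    Module.finrank K V = n →
    ∃ (i r : ℕ) (ρ : QF K r), ρ.Anisotropic ∧
      QIsometric K q ((QuadraticMap.pi fun _ : Fin i => binQF K 0 0).prod ρ) := by
  induction n using Nat.strong_induction_on with
  | _ n ih =>
    intro V _ _ _ q hq hn
    by_cases ha : q.Anisotropic
    · obtain ⟨ρ, e⟩ := isometric_fin q
      refine ⟨0, _, ρ, fun x hx => ?_, QIsometric.trans e (QIsometric.symm
        (isometric_uniqueProd _ _))⟩
      have h₀ : e.some.symm x = 0 := ha _ (by rw [e.some.symm.map_app, hx])
      simpa using congrArg e.some h₀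
    · rw [QuadraticMap.Anisotropic] at ha
      push Not at ha
      obtain ⟨x, hx, hx0⟩ := ha
      obtain ⟨y, hxy, hy⟩ := exists_hyperbolic_pair hq hx0 hx
      have hr := finrank_perp q hxy
      obtain ⟨i, r, ρ, hρ, e⟩ := ih (Module.finrank K (perp q x y)) (by lia) (perpForm q x y)
        (nonsingular_perpForm hq hxy) rfl
      refine ⟨i + 1, r, ρ, hρ, ?_⟩
      have e₁ := QIsometric.symm (isometric_split q hxy)
      rw [hx, hy] at e₁
      have e₂ : QIsometric K _ _ := QIsometric.trans e₁ (QIsometric.prod (QIsometric.refl _) e)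
      have e₃ : QIsometric K _ _ := QIsometric.prod
        (isometric_pi_succ fun _ : Fin (i + 1) => binQF K 0 0) (QIsometric.refl ρ)
      refine QIsometric.trans e₂ (QIsometric.trans ?_ e₃)
      exact QIsometric.symm (isometric_prodAssoc _ _ _)

theorem exists_witt_decomposition [FiniteDimensional K V] {q : QuadraticForm K V}
    (hq : Nonsingular K q) : ∃ (i r : ℕ) (ρ : QF K r), ρ.Anisotropic ∧
      QIsometric K q (oSum K (oSum K (oSumFam K fun _ : Fin i => binQF K 0 0) ρ)
        (diagQF K (0 : Fin 0 → K))) := by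
  obtain ⟨i, r, ρ, hρ, e⟩ := exists_witt_decomposition_pi _ q hq rfl
  exact ⟨i, r, ρ, hρ, QIsometric.trans e (QIsometric.symm (isometric_witt_sum i ρ))⟩

theorem metabolic_of_witt_decomposition {q : QuadraticForm K V} {q' : QuadraticForm K V'}
    {i j i' j' r : ℕ} {ρ : QF K r} (hρ : Nonsingular K ρ)
    (e : QIsometric K q (oSum K (oSum K (oSumFam K fun _ : Fin i => binQF K 0 0) ρ)
        (diagQF K (0 : Fin j → K))))
    (e' : QIsometric K q' (oSum K (oSum K (oSumFam K fun _ : Fin i' => binQF K 0 0) ρ)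
        (diagQF K (0 : Fin j' → K)))) :
    Metabolic (q.prod q') := by
  have hd : ∀ n : ℕ, diagQF K (0 : Fin n → K) = 0 := fun n => by
    ext x
    simp [diagQF, QuadraticMap.weightedSumSquares_apply]
  have key : ∀ {i j : ℕ}, QIsometric K (oSum K (oSum K (oSumFam K fun _ : Fin i => binQF K 0 0) ρ)
      (diagQF K (0 : Fin j → K)))
      (((oSumFam K fun _ : Fin i => binQF K 0 0).prod ρ).prod (0 : QF K j)) := fun {i j} => by
    rw [← hd]
    exact QIsometric.trans (isometric_oSum _ _) (QIsometric.prod (isometric_oSum _ _)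
      (QIsometric.refl _))
  have hm : Metabolic ((((oSumFam K fun _ : Fin i => binQF K 0 0).prod
      (oSumFam K fun _ : Fin i' => binQF K 0 0)).prod (ρ.prod ρ)).prod
      ((0 : QF K j).prod (0 : QF K j'))) :=
    (((metabolic_hyperbolic i).prod (metabolic_hyperbolic i')).prod
      (metabolic_prod_of_isometric hρ (QIsometric.refl _))).prod
      (metabolic_zero.prod metabolic_zero)
  refine Metabolic.of_isometric ?_ (QIsometric.symm (QIsometric.prod (QIsometric.trans e key)
    (QIsometric.trans e' key)))
  refine hm.of_isometric (QIsometric.trans (QIsometric.prod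
    (isometric_prodProdProdComm _ _ _ _) (QIsometric.refl _))
    (isometric_prodProdProdComm _ _ _ _))

theorem isometric_of_metabolic_prod [FiniteDimensional K V] [FiniteDimensional K V']
    {q : QuadraticForm K V} {q' : QuadraticForm K V'} (hq : Nonsingular K q)
    (hq' : Nonsingular K q') (ha : q.Anisotropic) (ha' : q'.Anisotropic)
    (h : Metabolic (q.prod q')) : QIsometric K q q' := by
  obtain ⟨L, h₁, h₂⟩ := h.two_mul_finrank (nonsingular_prod hq hq')
  have hsum : ∀ z : L, q' z.1.2 = q z.1.1 := fun z => by
    have := h₁ _ z.2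
    rw [QuadraticMap.prod_apply] at this
    exact (CharTwo.add_eq_zero.1 this).symm
  let f := (LinearMap.fst K V V').comp L.subtype
  let g := (LinearMap.snd K V V').comp L.subtype
  have hf : Function.Injective f := by
    rw [← LinearMap.ker_eq_bot, LinearMap.ker_eq_bot']
    intro z hz
    have hz₁ : z.1.1 = 0 := hz
    have hz₂ : z.1.2 = 0 := ha' _ (by rw [hsum, hz₁, map_zero])
    exact Subtype.ext (Prod.ext hz₁ hz₂)
  have hg : Function.Injective g := by
    rw [← LinearMap.ker_eq_bot, LinearMap.ker_eq_bot']
    intro z hz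
    have hz₂ : z.1.2 = 0 := hz
    have hz₁ : z.1.1 = 0 := ha _ (by rw [← hsum, hz₂, map_zero])
    exact Subtype.ext (Prod.ext hz₁ hz₂)
  have d₁ := LinearMap.finrank_le_finrank_of_injective hf
  have d₂ := LinearMap.finrank_le_finrank_of_injective hg
  rw [Module.finrank_prod] at h₂
  let ef := LinearEquiv.ofInjectiveOfFinrankEq f hf (by lia)
  let eg := LinearEquiv.ofInjectiveOfFinrankEq g hg (by lia)
  refine isometryEquiv_of_linearEquiv (ef.symm.trans eg) fun x => ?_
  obtain ⟨z, rfl⟩ := ef.surjective x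
  change q' (eg (ef.symm (ef z))) = q (ef z)
  rw [ef.symm_apply_apply]
  exact hsum z

theorem cl_eq_of_witt_decomposition [FiniteDimensional K V] {q : QuadraticForm K V}
    (hq : Nonsingular K q) {i r : ℕ} {ρ : QF K r} (hn : Nonsingular K ρ)
    (e : QIsometric K q (oSum K (oSum K (oSumFam K fun _ : Fin i => binQF K 0 0) ρ)
      (diagQF K (0 : Fin 0 → K)))) : cl q hq = cl ρ hn := by
  rw [cl_eq_iff]
  exact metabolic_of_witt_decomposition (i' := 0) (j' := 0) hn e (QIsometric.symm
    (QIsometric.trans (isometric_witt_sum 0 ρ) (isometric_uniqueProd _ _)))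

theorem wittEquiv_iff [FiniteDimensional K V] [FiniteDimensional K V']
    {q : QuadraticForm K V} {q' : QuadraticForm K V'} (hq : Nonsingular K q)
    (hq' : Nonsingular K q') : WittEquiv K q q' ↔ cl q hq = cl q' hq' := by
  constructor
  · rintro ⟨r, ρ, -, ⟨i, j, e⟩, ⟨i', j', e'⟩⟩
    exact cl_eq_iff.2 (metabolic_of_witt_decomposition (nonsingular_of_witt_decomposition hq e)
      e e')
  · intro h
    obtain ⟨i, r, ρ, hρ, e⟩ := exists_witt_decomposition hq
    obtain ⟨i', r', ρ', hρ', e'⟩ := exists_witt_decomposition hq'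
    have hn := nonsingular_of_witt_decomposition hq e
    have hn' := nonsingular_of_witt_decomposition hq' e'
    rw [cl_eq_of_witt_decomposition hq hn e, cl_eq_of_witt_decomposition hq' hn' e',
      cl_eq_iff] at h
    have eρ := isometric_of_metabolic_prod hn hn' hρ hρ' h
    refine ⟨r, ρ, hρ, ⟨i, 0, e⟩, ⟨i', 0, QIsometric.trans e' ?_⟩⟩
    refine QIsometric.trans (isometric_oSum _ _) (QIsometric.trans ?_
      (QIsometric.symm (isometric_oSum _ _)))
    refine QIsometric.prod (QIsometric.trans (isometric_oSum _ _) (QIsometric.trans ?_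
      (QIsometric.symm (isometric_oSum _ _)))) (QIsometric.refl _)
    exact QIsometric.prod (QIsometric.refl _) (QIsometric.symm eρ)

end WittDecomposition

section Identity

variable {K : Type} [Field K] [CharP K 2]

theorem nonsingular_pf2 {g : K} (hg : g ≠ 0) (h : K) : Nonsingular K (pf2 K g h) :=
  nonsingular_oSum (nonsingular_binQF 1 h) (nonsingular_smul (nonsingular_binQF 1 h) hg)

theorem cl_pf2 {g : K} (hg : g ≠ 0) (h : K) :
    cl (pf2 K g h) (nonsingular_pf2 hg h) = binCl 1 h + binCl g (h / g) := by
  have := cl_oSum (nonsingular_binQF (1 : K) h) (nonsingular_smul (nonsingular_binQF 1 h) hg)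
  rw [cl_smul_binQF 1 h hg, mul_one] at this
  exact this

theorem wittEquiv_pfister_identity {u v e : K} (hu : u ≠ 0) (hv : v ≠ 0) (he : e ≠ 0)
    (hg : e ^ 3 + u * e ^ 2 ≠ 0) :
    WittEquiv K (pf2 K (e ^ 3 + u * e ^ 2) (u ^ 2 * v ^ 2 / e ^ 2))
      (oSum K (oSum K (binQF K 1 (u * v / e)) (u • binQF K 1 (u * v / e)))
        (oSum K (u • binQF K 1 v) ((u * (v + u * v / e)) • binQF K 1 v))) := by
  obtain ⟨r, hr⟩ : ∃ r, r = u * v / e := ⟨_, rfl⟩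
  have hr0 : r ≠ 0 := by
    rw [hr]
    positivity
  have heu : e + u ≠ 0 := fun h => hg (by linear_combination e ^ 2 * h)
  have hre : r * e = u * v := by
    rw [hr]
    field_simp
  obtain ⟨k, hk⟩ : ∃ k, k = u * (v + r) := ⟨_, rfl⟩
  have hkr : k = r * (e + u) := by
    rw [hk]
    linear_combination -hre
  have hk0 : k ≠ 0 := by
    rw [hkr]
    exact mul_ne_zero hr0 heu
  rw [← hr, ← hk, show u ^ 2 * v ^ 2 / e ^ 2 = r ^ 2 by rw [hr]; ring]
  have n₁ := nonsingular_smul (nonsingular_binQF 1 r) hu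
  have n₂ := nonsingular_smul (nonsingular_binQF 1 v) hu
  have n₃ := nonsingular_smul (nonsingular_binQF 1 v) hk0
  rw [wittEquiv_iff (nonsingular_pf2 hg _)
    (nonsingular_oSum (nonsingular_oSum (nonsingular_binQF 1 r) n₁) (nonsingular_oSum n₂ n₃)),
    cl_pf2 hg, cl_oSum (nonsingular_oSum (nonsingular_binQF 1 r) n₁) (nonsingular_oSum n₂ n₃),
    cl_oSum (nonsingular_binQF 1 r) n₁, cl_oSum n₂ n₃, cl_smul_binQF 1 r hu,
    cl_smul_binQF 1 v hu, cl_smul_binQF 1 v hk0]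
  change _ = binCl 1 r + _ + _
  have s₁ : binCl 1 (r ^ 2) = binCl 1 r := by
    simpa using binCl_sq_right one_ne_zero r
  have s₂ : binCl (e ^ 3 + u * e ^ 2) (r ^ 2 / (e ^ 3 + u * e ^ 2)) = binCl k (r / k) := by
    rw [binCl_sq_right hg]
    have h₁ : binCl (e ^ 3 + u * e ^ 2) (r / (e ^ 3 + u * e ^ 2)) =
        binCl (e + u) (r / (e + u)) := by
      rw [← binCl_scale (e + u) _ he]
      congr 1
      · ring
      · rw [div_div]
        congr 1
        ring
    have h₂ : binCl (e + u) (r / (e + u)) = binCl (1 / k) (k * r) := by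
      rw [← binCl_scale _ _ hr0, binCl_comm, hkr]
      congr 1 <;> field_simp
    rw [h₁, h₂, ← binCl_scale _ _ hk0]
    congr 1 <;> field_simp
  have s₃ : binCl k (r / k) + binCl k (v / k) = binCl u (r / u) + binCl u (v / u) := by
    rw [binCl_add, binCl_add, ← add_div, ← add_div]
    have h₁ : (r + v) / k = 1 / u := by
      rw [hk]
      have : v + r ≠ 0 := fun h => hk0 (by rw [hk, h, mul_zero])
      field_simp
      ring
    have h₂ : binCl k (1 / u) = binCl (1 / u) (u ^ 2 * ((r + v) / u)) := by
      rw [binCl_comm, hk]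
      congr 1
      field_simp
      ring
    rw [h₁, h₂, ← binCl_scale (1 / u) _ hu]
    congr 1 <;> field_simp
  have s₄ : binCl k (r / k) = binCl u (r / u) + binCl u (v / u) + binCl k (v / k) := by
    rw [← s₃, add_assoc, WittGroup.add_self, add_zero]
  simp only [mul_one]
  rw [s₁, s₂, s₄]
  abel

end Identity

section BaseChange

open TensorProduct

variable {K : Type} [Field K] (E : Type) [Field E] [Algebra K E]
  {V V' : Type} [AddCommGroup V] [Module K V] [AddCommGroup V'] [Module K V']

/-- The scalar extension of a quadratic form, as a form on the tensor product. -/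
noncomputable def baseChange (q : QuadraticForm K V) : QuadraticForm E (E ⊗[K] V) :=
  (LinearMap.BilinForm.baseChange E
    (LinearMap.BilinMap.toQuadraticMap_surjective q).choose).toQuadraticMap

theorem baseChange_tmul (q : QuadraticForm K V) (t : E) (x : V) :
    baseChange E q (t ⊗ₜ x) = t ^ 2 * algebraMap K E (q x) := by
  rw [baseChange, LinearMap.BilinMap.toQuadraticMap_apply, LinearMap.BilinForm.baseChange_tmul,
    ← LinearMap.BilinMap.toQuadraticMap_apply,
    (LinearMap.BilinMap.toQuadraticMap_surjective q).choose_spec, Algebra.smul_def]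
  ring

theorem polar_baseChange_tmul (q : QuadraticForm K V) (t s : E) (x y : V) :
    polar (baseChange E q) (t ⊗ₜ x) (s ⊗ₜ y) = t * s * algebraMap K E (polar q x y) := by
  have h := (LinearMap.BilinMap.toQuadraticMap_surjective q).choose_spec
  rw [baseChange, LinearMap.BilinMap.polar_toQuadraticMap, LinearMap.BilinForm.baseChange_tmul,
    LinearMap.BilinForm.baseChange_tmul]
  conv_rhs => rw [← h, LinearMap.BilinMap.polar_toQuadraticMap]
  simp only [Algebra.smul_def, map_add]
  ring

variable {E} in
theorem quadraticForm_tensor_ext {Q Q' : QuadraticForm E (E ⊗[K] V)}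
    (h : ∀ x, Q (1 ⊗ₜ x) = Q' (1 ⊗ₜ x)) : Q = Q' := by
  have hs : ∀ (Q : QuadraticForm E (E ⊗[K] V)) (t : E) (x : V),
      Q (t ⊗ₜ x) = t * t * Q (1 ⊗ₜ x) := fun Q t x => by
    rw [← smul_eq_mul, ← QuadraticMap.map_smul, smul_tmul', smul_eq_mul, mul_one]
  have hp₁ : ∀ x y, polar Q (1 ⊗ₜ x) (1 ⊗ₜ y) = polar Q' (1 ⊗ₜ x) (1 ⊗ₜ y) := fun x y => by
    simp only [polar, ← tmul_add, h]
  have hp : ∀ (t s : E) x y, polar Q (t ⊗ₜ x) (s ⊗ₜ y) = polar Q' (t ⊗ₜ x) (s ⊗ₜ y) := by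
    intro t s x y
    rw [← mul_one t, ← mul_one s, ← smul_eq_mul, ← smul_eq_mul, ← smul_tmul', ← smul_tmul',
      polar_smul_left, polar_smul_right, hp₁, polar_smul_left, polar_smul_right]
  have hp₂ : ∀ z w, polar Q z w = polar Q' z w := by
    intro z w
    induction z using TensorProduct.induction_on with
    | zero => simp
    | add a b ha hb => rw [polar_add_left, polar_add_left, ha, hb]
    | tmul t x =>
      induction w using TensorProduct.induction_on with
      | zero => simp
      | add a b ha hb => rw [polar_add_right, polar_add_right, ha, hb]
      | tmul s y => exact hp t s x y
  refine QuadraticMap.ext fun z => ?_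
  induction z using TensorProduct.induction_on with
  | zero => simp
  | add a b ha hb => rw [QuadraticMap.map_add Q, QuadraticMap.map_add Q', ha, hb, hp₂]
  | tmul t x => rw [hs, hs Q', h]

variable {E} in
theorem isometric_baseChange {W : Type} [AddCommGroup W] [Module E W] {Q : QuadraticForm E W}
    {q : QuadraticForm K V} (e : E ⊗[K] V ≃ₗ[E] W)
    (h : ∀ x, Q (e (1 ⊗ₜ x)) = algebraMap K E (q x)) : QIsometric E (baseChange E q) Q := by
  have : Q.comp e.toLinearMap = baseChange E q := quadraticForm_tensor_ext fun x => by
    simp [h, baseChange_tmul]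
  refine isometryEquiv_of_linearEquiv e fun z => ?_
  rw [← this]
  rfl

theorem exists_repr_of_polar_eq_zero {q : QuadraticForm K V} {S : Set V} {z : E ⊗[K] V}
    (h : ∀ y ∈ S, polar (baseChange E q) z (1 ⊗ₜ y) = 0) :
    z ∈ Submodule.span E ((fun x : V => (1 : E) ⊗ₜ[K] x) '' {x | ∀ y ∈ S, polar q x y = 0}) := by
  obtain ⟨c, rfl⟩ := TensorProduct.eq_repr_basis_left (Module.Basis.ofVectorSpace K E) z
  refine Submodule.sum_mem _ fun i _ => ?_
  have hi : c i ∈ {x | ∀ y ∈ S, polar q x y = 0} := by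
    intro y hy
    have h₁ := h y hy
    change polarBilin (baseChange E q) _ _ = 0 at h₁
    rw [Finsupp.sum, map_sum, LinearMap.sum_apply] at h₁
    have h₂ : c.sum (fun j n => polar q n y • Module.Basis.ofVectorSpace K E j) = 0 := by
      rw [← h₁]
      refine Finset.sum_congr rfl fun j _ => ?_
      change _ = polar (baseChange E q) _ _
      rw [polar_baseChange_tmul]
      dsimp only
      rw [Algebra.smul_def]
      ring
    by_cases hc : i ∈ c.support
    · exact linearIndependent_iff'.1 (Module.Basis.ofVectorSpace K E).linearIndependent _ _ h₂ i hc
    · rw [Finsupp.notMem_support_iff.1 hc]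
      simp
  have : (Module.Basis.ofVectorSpace K E i) ⊗ₜ[K] c i =
      Module.Basis.ofVectorSpace K E i • ((1 : E) ⊗ₜ[K] c i) := by
    rw [smul_tmul', smul_eq_mul, mul_one]
  dsimp only
  rw [this]
  exact Submodule.smul_mem _ _ (Submodule.subset_span ⟨_, hi, rfl⟩)

theorem nonsingular_baseChange {q : QuadraticForm K V} (hq : Nonsingular K q) :
    Nonsingular E (baseChange E q) := by
  intro z hz
  have h := exists_repr_of_polar_eq_zero (S := Set.univ) E fun y _ => hz (1 ⊗ₜ y)
  have h₀ : {x | ∀ y ∈ (Set.univ : Set V), polar q x y = 0} = {0} := by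
    ext x
    exact ⟨fun hx => hq x fun y => hx y trivial, fun hx y _ => by rw [hx]; simp⟩
  rw [h₀] at h
  simpa using h

theorem Metabolic.baseChange {q : QuadraticForm K V} (h : Metabolic q) :
    Metabolic (baseChange E q) := by
  obtain ⟨L, h₁, h₂⟩ := h
  refine ⟨LinearMap.range (L.subtype.baseChange E), ?_, fun z hz => ?_⟩
  · rintro _ ⟨z, rfl⟩
    have : (WittKernel.baseChange E q).comp (L.subtype.baseChange E) = 0 :=
      quadraticForm_tensor_ext fun x => by
        simp [baseChange_tmul, h₁ _ x.2]
    exact DFunLike.congr_fun this z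
  · have h := exists_repr_of_polar_eq_zero (S := L) E fun y hy =>
      hz (1 ⊗ₜ y) ⟨1 ⊗ₜ ⟨y, hy⟩, by simp⟩
    refine Submodule.span_le.2 ?_ h
    rintro _ ⟨x, hx, rfl⟩
    exact ⟨1 ⊗ₜ ⟨x, h₂ x hx⟩, by simp⟩

theorem isometric_baseChange_prod (q : QuadraticForm K V) (q' : QuadraticForm K V') :
    QIsometric E (baseChange E (q.prod q')) ((baseChange E q).prod (baseChange E q')) :=
  isometric_baseChange (TensorProduct.prodRight K E E V V') fun x => by
    simp [baseChange_tmul]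

theorem toQuadraticForm'_qMat {n : ℕ} (q : QF K n) : (qMat K q).toQuadraticForm' = q := by
  conv_rhs => rw [← QuadraticMap.toQuadraticMap_toBilin q (Pi.basisFun K (Fin n))]
  change LinearMap.BilinMap.toQuadraticMap (Matrix.toLinearMap₂' K (qMat K q)) = _
  congr 1
  refine (Pi.basisFun K (Fin n)).ext fun i => (Pi.basisFun K (Fin n)).ext fun j => ?_
  rw [QuadraticMap.toBilin_apply]
  simp [Matrix.toLinearMap₂'_apply, Pi.single_apply]
  rfl

theorem extQF_apply {n : ℕ} (q : QF K n) (x : Fin n → K) :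
    extQF K E q (fun i => algebraMap K E (x i)) = algebraMap K E (q x) := by
  conv_rhs => rw [← toQuadraticForm'_qMat q]
  change Matrix.toLinearMap₂' E ((qMat K q).map (algebraMap K E)) _ _ =
    algebraMap K E (Matrix.toLinearMap₂' K (qMat K q) x x)
  simp [Matrix.toLinearMap₂'_apply]

theorem isometric_extQF {n : ℕ} (q : QF K n) :
    QIsometric E (baseChange E q) (extQF K E q) :=
  isometric_baseChange (TensorProduct.piScalarRight K E E (Fin n)) fun x => by
    rw [← extQF_apply]
    congr 1
    ext i
    simp [Algebra.smul_def]

variable [CharP K 2] [CharP E 2]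

/-- The restriction map on Witt groups of quadratic forms. -/
noncomputable def restriction : WittGroup K →+ WittGroup E where
  toFun := Quotient.map (fun A => ⟨E ⊗[K] A.carrier, baseChange E A.form,
    nonsingular_baseChange E A.nonsingular⟩) fun A B h =>
      (Metabolic.baseChange E h).of_isometric (isometric_baseChange_prod E A.form B.form)
  map_zero' := cl_eq_zero_iff.2 (metabolic_zero.baseChange E)
  map_add' a b := by
    induction a using WittGroup.ind with | h V q hq => ?_
    induction b using WittGroup.ind with | h V' q' hq' => ?_
    exact cl_eq_of_isometric (isometric_baseChange_prod E q q')

variable [FiniteDimensional K V]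

theorem restriction_cl {q : QuadraticForm K V} (hq : Nonsingular K q) :
    restriction E (cl q hq) = cl (baseChange E q) (nonsingular_baseChange E hq) :=
  rfl

theorem restriction_binCl (a b : K) :
    restriction E (binCl a b) = binCl (algebraMap K E a) (algebraMap K E b) := by
  rw [binCl, restriction_cl, cl_eq_binCl (x := 1 ⊗ₜ ![1, 0]) (y := 1 ⊗ₜ ![0, 1]) _
    (by simp [polar_baseChange_tmul]) (by simp)]
  simp [baseChange_tmul]

theorem restriction_cl_smul_sq {q : QuadraticForm K V} (hq : Nonsingular K q) {u : K} (hu : u ≠ 0)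
    {μ : E} (hμ : μ ^ 2 = algebraMap K E u) :
    restriction E (cl (u • q) (nonsingular_smul hq hu)) = restriction E (cl q hq) := by
  have hμ0 : μ ≠ 0 := by
    rintro rfl
    rw [zero_pow two_ne_zero, eq_comm, map_eq_zero] at hμ
    exact hu hμ
  rw [restriction_cl, restriction_cl]
  refine cl_eq_of_isometric (isometric_baseChange (LinearEquiv.smulOfNeZero E _ μ hμ0) fun x => ?_)
  simp [smul_tmul', baseChange_tmul, hμ]

theorem inWqKernel_iff {n : ℕ} {q : QF K n} (hq : Nonsingular K q) :
    InWqKernel K E q ↔ restriction E (cl q hq) = 0 := by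
  rw [InWqKernel, wittEquiv_iff (nonsingular_of_isometric (nonsingular_baseChange E hq)
    (isometric_extQF E q)) (nonsingular_of_subsingleton _), restriction_cl,
    cl_eq_of_isometric (isometric_extQF E q), cl_eq_zero_iff.2 (metabolic_of_subsingleton (0 : QF E 0))]

end BaseChange

section Field

open Polynomial

variable {F : Type} [Field F] {E : Type} [Field E] [Algebra F E] {u v : F} {μ ν : E}

theorem adjoin_mul_eq_top [CharP E 2] (hu : u ≠ 0) (hv : v ≠ 0) (hμ : μ ^ 2 = algebraMap F E u)
    (hν : ν ^ 2 + ν + algebraMap F E v = 0) (hE : IntermediateField.adjoin F {μ, ν} = ⊤) :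
    IntermediateField.adjoin F {μ * ν} = ⊤ := by
  have hu' : algebraMap F E u ≠ 0 := by simpa using hu
  have hν0 : ν ≠ 0 := by
    rintro rfl
    simp at hν
    exact hv hν
  have h₁ : μ * ν ∈ IntermediateField.adjoin F {μ * ν} :=
    IntermediateField.mem_adjoin_simple_self F _
  have h₂ : ν ∈ IntermediateField.adjoin F {μ * ν} := by
    have : ν = (μ * ν) ^ 2 / algebraMap F E u + algebraMap F E v := by
      field_simp
      linear_combination (-ν ^ 2) * hμ - algebraMap F E u * hν +
        algebraMap F E u * ν * CharTwo.two_eq_zero (R := E)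
    have h := add_mem (div_mem (pow_mem h₁ 2) (algebraMap_mem _ u)) (algebraMap_mem _ v)
    rwa [← this] at h
  rw [eq_top_iff, ← hE, IntermediateField.adjoin_le_iff]
  rintro x (rfl | rfl)
  · simpa [hν0] using div_mem h₁ h₂
  · exact h₂

theorem minpoly_mul [CharP E 2] (hu : u ≠ 0) (hv : v ≠ 0) (hμ : μ ^ 2 = algebraMap F E u)
    (hν : ν ^ 2 + ν + algebraMap F E v = 0) (hdim : Module.finrank F E = 4)
    (hE : IntermediateField.adjoin F {μ, ν} = ⊤) :
    minpoly F (μ * ν) = X ^ 4 + C u * X ^ 2 + C (u ^ 2 * v ^ 2) := by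
  have : FiniteDimensional F E := Module.finite_of_finrank_pos (by lia)
  have hint : IsIntegral F (μ * ν) := Algebra.IsIntegral.isIntegral _
  have hdeg : (minpoly F (μ * ν)).natDegree = 4 := by
    rw [← IntermediateField.adjoin.finrank hint, adjoin_mul_eq_top hu hv hμ hν hE,
      IntermediateField.finrank_top', hdim]
  have hp : (X ^ 4 + C u * X ^ 2 + C (u ^ 2 * v ^ 2) : F[X]).natDegree = 4 := by compute_degree!
  refine (Polynomial.eq_of_monic_of_dvd_of_natDegree_le (minpoly.monic hint) ?_ ?_ ?_).symm
  · monicity!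
  · refine minpoly.dvd _ _ ?_
    simp only [map_add, map_mul, map_pow, aeval_X, aeval_C]
    linear_combination (μ ^ 2 * ν ^ 4 + algebraMap F E u * ν ^ 4 + algebraMap F E u * ν ^ 2) * hμ +
      algebraMap F E u ^ 2 * (ν ^ 2 + ν + algebraMap F E v) * hν -
      algebraMap F E u ^ 2 * (ν ^ 3 + algebraMap F E v * ν ^ 2 + algebraMap F E v * ν) *
        CharTwo.two_eq_zero (R := E)
  · rw [hp, hdeg]

theorem exists_basis [CharP E 2] (hμ : μ ^ 2 = algebraMap F E u)
    (hν : ν ^ 2 + ν + algebraMap F E v = 0) (hdim : Module.finrank F E = 4)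
    (hE : IntermediateField.adjoin F {μ, ν} = ⊤) :
    ∃ b : Module.Basis (Fin 4) F E, ⇑b = ![1, μ, ν, μ * ν] := by
  have : FiniteDimensional F E := Module.finite_of_finrank_pos (by lia)
  let S : Subalgebra F E :=
    { carrier := {z | ∃ a b c d : F, z = algebraMap F E a + algebraMap F E b * μ +
        algebraMap F E c * ν + algebraMap F E d * (μ * ν)}
      mul_mem' := by
        rintro _ _ ⟨a, b, c, d, rfl⟩ ⟨a', b', c', d', rfl⟩
        refine ⟨a * a' + u * b * b' + v * c * c' + u * v * d * d',
          a * b' + b * a' + v * (c * d' + d * c'),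
          a * c' + c * a' + c * c' + u * (b * d' + d * b') + u * d * d',
          a * d' + d * a' + b * c' + c * b' + c * d' + d * c', ?_⟩
        have hν' : ν ^ 2 = ν + algebraMap F E v := by
          linear_combination hν - (ν + algebraMap F E v) * CharTwo.two_eq_zero (R := E)
        simp only [map_add, map_mul]
        linear_combination (algebraMap F E b * algebraMap F E b' +
          algebraMap F E d * algebraMap F E d' * ν ^ 2 +
          (algebraMap F E b * algebraMap F E d' + algebraMap F E d * algebraMap F E b') * ν) * hμ +
          (algebraMap F E c * algebraMap F E c' +
          algebraMap F E d * algebraMap F E d' * algebraMap F E u +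
          (algebraMap F E c * algebraMap F E d' + algebraMap F E d * algebraMap F E c') * μ) * hν'
      add_mem' := by
        rintro _ _ ⟨a, b, c, d, rfl⟩ ⟨a', b', c', d', rfl⟩
        exact ⟨a + a', b + b', c + c', d + d', by simp only [map_add]; ring⟩
      algebraMap_mem' := fun a => ⟨a, 0, 0, 0, by simp⟩ }
  have hS : S = ⊤ := by
    rw [eq_top_iff, ← IntermediateField.top_toSubalgebra, ← hE,
      IntermediateField.adjoin_toSubalgebra, Algebra.adjoin_le_iff]
    rintro x (rfl | rfl)
    · exact ⟨0, 1, 0, 0, by simp⟩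
    · exact ⟨0, 0, 1, 0, by simp⟩
  refine ⟨basisOfTopLeSpanOfCardEqFinrank ![1, μ, ν, μ * ν] (fun z _ => ?_) (by simp [hdim]),
    coe_basisOfTopLeSpanOfCardEqFinrank _ _ _⟩
  obtain ⟨a, b, c, d, rfl⟩ : z ∈ S := hS ▸ trivial
  rw [Submodule.mem_span_range_iff_exists_fun]
  refine ⟨![a, b, c, d], ?_⟩
  simp [Fin.sum_univ_four, Algebra.smul_def]

end Field

section Kernel

open TensorProduct

variable {K : Type} [Field K] [CharP K 2]

/-- The subgroup `⟨1,u⟩_b ⊗ W_qF + WF ⊗ [1,v]` of the Witt group. -/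
noncomputable def biquadraticKernel {u : K} (hu : u ≠ 0) (v : K) : AddSubgroup (WittGroup K) :=
  AddSubgroup.closure
    ({a | ∃ (n : ℕ) (q : QF K n) (hq : Nonsingular K q),
        a = cl q hq + cl (u • q) (nonsingular_smul hq hu)} ∪
      {a | ∃ c : K, c ≠ 0 ∧ a = binCl c (v / c)})

theorem binCl_div_mem {u : K} (hu : u ≠ 0) (v : K) {c : K} (hc : c ≠ 0) :
    binCl c (v / c) ∈ biquadraticKernel hu v :=
  AddSubgroup.subset_closure (Or.inr ⟨c, hc, rfl⟩)

theorem binCl_add_smul_mem {u : K} (hu : u ≠ 0) (v a b : K) :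
    binCl (u * a) b + binCl a (u * b) ∈ biquadraticKernel hu v := by
  refine AddSubgroup.subset_closure (Or.inl ⟨2, _, nonsingular_binQF a (u * b), ?_⟩)
  rw [cl_smul_binQF a (u * b) hu, mul_div_cancel_left₀ _ hu, add_comm]
  rfl

theorem exists_of_mem_biquadraticKernel {u v : K} {hu : u ≠ 0} {a : WittGroup K}
    (ha : a ∈ biquadraticKernel hu v) :
    ∃ (k : ℕ) (q : QF K k) (hq : Nonsingular K q) (l : ℕ) (c : Fin l → K), (∀ i, c i ≠ 0) ∧
      a = cl q hq + cl (u • q) (nonsingular_smul hq hu) + ∑ i, binCl (c i) (v / c i) := by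
  induction ha using AddSubgroup.closure_induction with
  | mem a ha =>
    rcases ha with ⟨n, q, hq, rfl⟩ | ⟨c, hc, rfl⟩
    · exact ⟨n, q, hq, 0, ![], by simp, by simp⟩
    · refine ⟨0, 0, nonsingular_of_subsingleton _, 1, ![c], by simpa using hc, ?_⟩
      rw [cl_eq_zero_iff.2 metabolic_zero, cl_eq_zero_iff.2 (metabolic_of_subsingleton _)]
      simp
  | zero =>
    refine ⟨0, 0, nonsingular_of_subsingleton _, 0, ![], by simp, ?_⟩
    rw [cl_eq_zero_iff.2 metabolic_zero, cl_eq_zero_iff.2 (metabolic_of_subsingleton _)]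
    simp
  | neg a _ ih => exact ih
  | add a b _ _ iha ihb =>
    obtain ⟨k, q, hq, l, c, hc, rfl⟩ := iha
    obtain ⟨k', q', hq', l', c', hc', rfl⟩ := ihb
    refine ⟨k + k', oSum K q q', nonsingular_oSum hq hq', l + l', Fin.append c c',
      Fin.addCases (by simpa using hc) (by simpa using hc'), ?_⟩
    have h : cl (u • oSum K q q') (nonsingular_smul (nonsingular_oSum hq hq') hu) =
        cl (u • q) (nonsingular_smul hq hu) + cl (u • q') (nonsingular_smul hq' hu) := by
      rw [← cl_oSum]
      refine cl_eq_of_isometric (isometryEquiv_of_linearEquiv (LinearEquiv.refl K _) fun x => ?_)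
      simp [oSum, mul_add]
    rw [h, cl_oSum hq hq', Fin.sum_univ_add]
    simp only [Fin.append_left, Fin.append_right]
    abel

variable {E : Type} [Field E] [CharP E 2] [Algebra K E] {u v : K} {μ ν : E}

theorem restriction_eq_zero_of_mem (hu : u ≠ 0) (hμ : μ ^ 2 = algebraMap K E u)
    (hν : ν ^ 2 + ν + algebraMap K E v = 0) {a : WittGroup K}
    (ha : a ∈ biquadraticKernel hu v) : restriction E a = 0 := by
  induction ha using AddSubgroup.closure_induction with
  | mem a ha =>
    rcases ha with ⟨n, q, hq, rfl⟩ | ⟨c, hc, rfl⟩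
    · rw [map_add, restriction_cl_smul_sq E hq hu hμ, WittGroup.add_self]
    · rw [restriction_binCl]
      have hc' : algebraMap K E c ≠ 0 := by simpa using hc
      refine binCl_eq_zero (ν / algebraMap K E c) ?_
      rw [map_div₀]
      field_simp
      linear_combination hν
  | zero => exact map_zero _
  | add a b _ _ iha ihb => rw [map_add, iha, ihb, add_zero]
  | neg a _ ih => exact ih

variable {V : Type} [AddCommGroup V] [Module K V] [FiniteDimensional K V]

theorem exists_vectors_of_restriction_eq_zero (hμ : μ ^ 2 = algebraMap K E u)
    (hν : ν ^ 2 + ν + algebraMap K E v = 0) (hv : v ≠ 0) (b : Module.Basis (Fin 4) K E)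
    (hb : ⇑b = ![1, μ, ν, μ * ν]) {q : QuadraticForm K V} (hq : Nonsingular K q)
    (h : restriction E (cl q hq) = 0) (hV : 0 < Module.finrank K V) :
    ∃ x y w : V, ¬(x = 0 ∧ y = 0 ∧ w = 0) ∧ polar q x w = 0 ∧ polar q y w = 0 ∧
      polar q x y = q y + u * q w ∧ q x = v * polar q x y := by
  have : FiniteDimensional K E := b.finiteDimensional_of_finite
  have hdim : Module.finrank K E = 4 := by simp [Module.finrank_eq_card_basis b]
  obtain ⟨L, hL, hL'⟩ := Metabolic.two_mul_finrank (nonsingular_baseChange E hq)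
    (cl_eq_zero_iff.1 h)
  have : FiniteDimensional K (E ⊗[K] V) := inferInstance
  rw [Module.finrank_baseChange] at hL'
  let g : L.restrictScalars K →ₗ[K] V :=
    (TensorProduct.lid K V).toLinearMap ∘ₗ (b.coord 1).rTensor V ∘ₗ (L.restrictScalars K).subtype
  have hfin : Module.finrank K (L.restrictScalars K) = 4 * Module.finrank E L := by
    change Module.finrank K L = _
    have : Module.Free E L := Module.Free.of_divisionRing E L
    rw [← Module.finrank_mul_finrank K E L, hdim]
  have hlt : Module.finrank K V < Module.finrank K (L.restrictScalars K) := by lia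
  have hg : LinearMap.ker g ≠ ⊥ := fun hg =>
    hlt.not_ge (LinearMap.finrank_le_finrank_of_injective (LinearMap.ker_eq_bot.1 hg))
  obtain ⟨⟨z, hz⟩, hgz, hz0⟩ := Submodule.exists_mem_ne_zero_of_ne_bot hg
  obtain ⟨c, rfl⟩ := TensorProduct.eq_repr_basis_left b z
  have hc : c 1 = 0 := by
    have : g ⟨_, hz⟩ = c 1 := by
      simp [g, Finsupp.sum_fintype, Fin.sum_univ_four]
    rw [← this]
    exact hgz
  have hz' : (c.sum fun i n => b i ⊗ₜ[K] n) =
      (1 : E) ⊗ₜ c 0 + ν ⊗ₜ c 2 + (μ * ν) ⊗ₜ c 3 := by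
    simp [Finsupp.sum_fintype, Fin.sum_univ_four, hb, hc]
  refine ⟨c 0, c 2, c 3, ?_, ?_⟩
  · rintro ⟨h₀, h₂, h₃⟩
    refine hz0 (Subtype.ext ?_)
    change (c.sum fun i n => b i ⊗ₜ[K] n) = 0
    rw [hz', h₀, h₂, h₃]
    simp
  have hq0 := hL _ hz
  rw [hz', QuadraticMap.map_add (baseChange E q), QuadraticMap.map_add (baseChange E q),
    polar_add_left] at hq0
  simp only [baseChange_tmul, polar_baseChange_tmul] at hq0
  have hν' : ν ^ 2 = ν + algebraMap K E v := by
    linear_combination hν - (ν + algebraMap K E v) * CharTwo.two_eq_zero (R := E)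
  have hli := Fintype.linearIndependent_iff.1 b.linearIndependent
    ![q (c 0) + v * q (c 2) + u * v * q (c 3), v * polar q (c 2) (c 3),
      q (c 2) + u * q (c 3) + polar q (c 0) (c 2), polar q (c 0) (c 3) + polar q (c 2) (c 3)] (by
    rw [hb]
    simp only [Fin.sum_univ_four, Algebra.smul_def, Matrix.cons_val, map_add, map_mul]
    linear_combination hq0 - (algebraMap K E (q (c 3)) * ν ^ 2) * hμ -
      (algebraMap K E (q (c 2)) + algebraMap K E (q (c 3)) * algebraMap K E u +
        algebraMap K E (polar q (c 2) (c 3)) * μ) * hν')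
  have h₀ := hli 0
  have h₁ := hli 1
  have h₂ := hli 2
  have h₃ := hli 3
  simp only [Matrix.cons_val] at h₀ h₁ h₂ h₃
  have h₁' := (mul_eq_zero.1 h₁).resolve_left hv
  rw [h₁', add_zero] at h₃
  refine ⟨h₃, h₁', ?_, ?_⟩
  · exact (CharTwo.add_eq_zero.1 h₂).symm
  · linear_combination h₀ - v * h₂

/-- The forms on spaces of dimension less than `n` whose Witt class becomes trivial over `E` have
their Witt class in `biquadraticKernel`. -/
def KernelBelow (E : Type) [Field E] [CharP E 2] [Algebra K E] (hu : u ≠ 0) (v : K) (n : ℕ) :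
    Prop :=
  ∀ (V : Type) [AddCommGroup V] [Module K V] [FiniteDimensional K V] (q : QuadraticForm K V)
    (hq : Nonsingular K q), Module.finrank K V < n → restriction E (cl q hq) = 0 →
    cl q hq ∈ biquadraticKernel hu v

theorem KernelBelow.mem {hu : u ≠ 0} {V' : Type} [AddCommGroup V'] [Module K V']
    [FiniteDimensional K V'] {q : QuadraticForm K V} {hq : Nonsingular K q}
    (H : KernelBelow E hu v (Module.finrank K V)) (hμ : μ ^ 2 = algebraMap K E u)
    (hν : ν ^ 2 + ν + algebraMap K E v = 0) (h : restriction E (cl q hq) = 0)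
    {q' : QuadraticForm K V'} (hq' : Nonsingular K q')
    (hlt : Module.finrank K V' < Module.finrank K V)
    (hadd : cl q hq + cl q' hq' ∈ biquadraticKernel hu v) : cl q hq ∈ biquadraticKernel hu v := by
  have h' := restriction_eq_zero_of_mem hu hμ hν hadd
  rw [map_add, h, zero_add] at h'
  exact ((biquadraticKernel hu v).add_mem_cancel_right (H V' q' hq' hlt h')).1 hadd

theorem KernelBelow.mem_of_plane {hu : u ≠ 0} {q : QuadraticForm K V} {hq : Nonsingular K q}
    (H : KernelBelow E hu v (Module.finrank K V)) (hμ : μ ^ 2 = algebraMap K E u)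
    (hν : ν ^ 2 + ν + algebraMap K E v = 0) (h : restriction E (cl q hq) = 0)
    {x y : V} (hxy : polar q x y = 1) (hmem : binCl (q x) (q y) ∈ biquadraticKernel hu v) :
    cl q hq ∈ biquadraticKernel hu v := by
  refine H.mem hμ hν h (nonsingular_perpForm hq hxy) ?_ ?_
  · have := finrank_perp q hxy
    lia
  · rwa [cl_split hq hxy, add_assoc, WittGroup.add_self, add_zero]

theorem KernelBelow.mem_of_plane_of_perp {hu : u ≠ 0} {q : QuadraticForm K V}
    {hq : Nonsingular K q} (H : KernelBelow E hu v (Module.finrank K V))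
    (hμ : μ ^ 2 = algebraMap K E u) (hν : ν ^ 2 + ν + algebraMap K E v = 0)
    (h : restriction E (cl q hq) = 0) {x y w : V} (hxy : polar q x y = 1) (hw : w ∈ perp q x y)
    (hw0 : w ≠ 0) {a : K}
    (hmem : binCl (q x) (q y) + binCl (q w) a ∈ biquadraticKernel hu v) :
    cl q hq ∈ biquadraticKernel hu v := by
  have hP := nonsingular_perpForm hq hxy
  obtain ⟨w', hw'⟩ := exists_polar_eq_one hP (x := ⟨w, hw⟩) (by simpa using hw0)
  have hP' := nonsingular_perpForm hP hw'
  refine H.mem hμ hν h (nonsingular_prod (nonsingular_binQF (q w) (q w' + a)) hP') ?_ ?_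
  · have h₁ := finrank_perp q hxy
    have h₂ := finrank_perp _ hw'
    rw [Module.finrank_prod, Module.finrank_fin_fun]
    lia
  · have h₁ : cl q hq = binCl (q x) (q y) + (binCl (q w) (q w') + cl _ hP') := by
      rw [cl_split hq hxy, cl_split hP hw']
      rfl
    rw [cl_prod (nonsingular_binQF _ _) hP', h₁]
    change _ + (binCl (q w) (q w' + a) + _) ∈ _
    rw [← binCl_add]
    convert hmem using 1
    generalize cl _ hP' = c
    calc _ = binCl (q x) (q y) + binCl (q w) a + (binCl (q w) (q w') + binCl (q w) (q w')) +
          (c + c) := by abel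
      _ = _ := by rw [WittGroup.add_self, WittGroup.add_self, add_zero, add_zero]

theorem mem_biquadraticKernel (hu : u ≠ 0) (hv : v ≠ 0) (hμ : μ ^ 2 = algebraMap K E u)
    (hν : ν ^ 2 + ν + algebraMap K E v = 0) (b : Module.Basis (Fin 4) K E)
    (hb : ⇑b = ![1, μ, ν, μ * ν]) (n : ℕ) : KernelBelow E hu v n := by
  induction n with
  | zero => exact fun V _ _ _ q hq hlt => absurd hlt (Nat.not_lt_zero _)
  | succ n ih =>
    intro V _ _ _ q hq hlt h
    have H : KernelBelow E hu v (Module.finrank K V) :=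
      fun V' _ _ _ q' hq' hlt' h' => ih V' q' hq' (by lia) h'
    rcases Nat.eq_zero_or_pos (Module.finrank K V) with h0 | hpos
    · have : Subsingleton V := Module.finrank_zero_iff.1 h0
      rw [cl_eq_zero_iff.2 (metabolic_of_subsingleton q)]
      exact zero_mem _
    by_cases hani : ∃ x, x ≠ 0 ∧ q x = 0
    · obtain ⟨x, hx, hx0⟩ := hani
      obtain ⟨y, hxy, hy⟩ := exists_hyperbolic_pair hq hx hx0
      refine H.mem_of_plane hμ hν h hxy ?_
      rw [hx0, hy, binCl_eq_zero 0 (by simp)]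
      exact zero_mem _
    have hani' : ∀ x, q x = 0 → x = 0 := fun x hx => by
      by_contra hx'
      exact hani ⟨x, hx', hx⟩
    obtain ⟨x, y, w, hne, hxw, hyw, hxy, hx⟩ :=
      exists_vectors_of_restriction_eq_zero hμ hν hv b hb hq h hpos
    by_cases hβ : polar q x y = 0
    · rw [hβ] at hxy hx
      have hx0 : x = 0 := hani' x (by rw [hx, mul_zero])
      have hyw' : q y = u * q w := CharTwo.add_eq_zero.1 hxy.symm
      have hw0 : w ≠ 0 := by
        rintro rfl
        exact hne ⟨hx0, hani' y (by simpa using hyw'), rfl⟩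
      have hqw : q w ≠ 0 := fun hqw => hw0 (hani' w hqw)
      obtain ⟨z, hyz, hwz⟩ := exists_polar_eq_one_and_eq_zero hq hw0 (y := y) fun t ht => by
        rw [ht, QuadraticMap.map_smul, smul_eq_mul] at hyw'
        have hut : u = t ^ 2 := by
          rw [pow_two]
          exact (mul_right_cancel₀ hqw hyw').symm
        have hμt : μ = algebraMap K E t := by
          rw [hut, map_pow] at hμ
          exact CharTwo.sq_injective hμ
        have := Fintype.linearIndependent_iff.1 b.linearIndependent ![t, 1, 0, 0] (by
          simp [hb, Fin.sum_univ_four, Algebra.smul_def, hμt, CharTwo.add_self_eq_zero]) 1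
        simp at this
      refine H.mem_of_plane_of_perp hμ hν h hyz (w := w) (mem_perp.2 ⟨hyw, ?_⟩) hw0
        (a := u * q z) ?_
      · rw [polar_comm, hwz]
      · rw [hyw']
        exact binCl_add_smul_mem hu v (q w) (q z)
    · have hyx : polar q y ((polar q x y)⁻¹ • x) = 1 := by
        rw [polar_smul_right, polar_comm q y x, smul_eq_mul, inv_mul_cancel₀ hβ]
      generalize polar q x y = β at *
      have hqx : q (β⁻¹ • x) = v / β := by
        rw [QuadraticMap.map_smul, hx, smul_eq_mul]
        field_simp
      by_cases hw0 : w = 0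
      · refine H.mem_of_plane hμ hν h hyx ?_
        rw [hw0, QuadraticMap.map_zero, mul_zero, add_zero] at hxy
        rw [hqx, ← hxy]
        exact binCl_div_mem hu v hβ
      · refine H.mem_of_plane_of_perp hμ hν h hyx (w := w) (mem_perp.2 ⟨hyw, ?_⟩) hw0
          (a := u * (v / β)) ?_
        · rw [polar_smul_left, hxw, smul_zero]
        · have hy : q y = β + u * q w := by
            linear_combination -hxy - u * q w * CharTwo.two_eq_zero (R := K)
          rw [hqx, hy, binCl_comm, ← binCl_add, binCl_comm, binCl_comm (v / β), add_assoc]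
          exact add_mem (binCl_div_mem hu v hβ) (binCl_add_smul_mem hu v _ _)

end Kernel

section Main

variable {K : Type} [Field K] [CharP K 2] {E : Type} [Field E] [CharP E 2] [Algebra K E]
  {u v : K} {μ ν : E}

theorem inWqKernel_iff_exists (hu : u ≠ 0) (hv : v ≠ 0) (hμ : μ ^ 2 = algebraMap K E u)
    (hν : ν ^ 2 + ν + algebraMap K E v = 0) (b : Module.Basis (Fin 4) K E)
    (hb : ⇑b = ![1, μ, ν, μ * ν]) {N : ℕ} {φ : QF K N} (hφ : Nonsingular K φ) :
    InWqKernel K E φ ↔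
      ∃ (k : ℕ) (q : QF K k), Nonsingular K q ∧
        ∃ (l : ℕ) (lam : Fin l → K), (∀ i, lam i ≠ 0) ∧
          WittEquiv K φ (oSum K (oSum K q (u • q)) (oSumFam K fun i => lam i • binQF K 1 v)) := by
  have hcl : ∀ {k : ℕ} {q : QF K k} (hq : Nonsingular K q) {l : ℕ} {lam : Fin l → K}
      (hlam : ∀ i, lam i ≠ 0),
      WittEquiv K φ (oSum K (oSum K q (u • q)) (oSumFam K fun i => lam i • binQF K 1 v)) ↔
        cl φ hφ = cl q hq + cl (u • q) (nonsingular_smul hq hu) +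
          ∑ i, binCl (lam i) (v / lam i) := by
    intro k q hq l lam hlam
    have h₁ := nonsingular_oSum hq (nonsingular_smul hq hu)
    have h₂ : ∀ i, Nonsingular K (lam i • binQF K 1 v) :=
      fun i => nonsingular_smul (nonsingular_binQF 1 v) (hlam i)
    have h₃ : ∀ i, cl (lam i • binQF K 1 v) (h₂ i) = binCl (lam i) (v / lam i) := fun i => by
      rw [cl_smul_binQF 1 v (hlam i), mul_one]
    rw [wittEquiv_iff hφ (nonsingular_oSum h₁ (nonsingular_oSumFam h₂)),
      cl_oSum h₁ (nonsingular_oSumFam h₂), cl_oSum hq (nonsingular_smul hq hu), cl_oSumFam h₂,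
      Finset.sum_congr rfl fun i _ => h₃ i]
  rw [inWqKernel_iff E hφ]
  constructor
  · intro h
    obtain ⟨k, q, hq, l, c, hc, hsum⟩ := exists_of_mem_biquadraticKernel
      (mem_biquadraticKernel hu hv hμ hν b hb _ _ φ hφ (Nat.lt_succ_self _) h)
    exact ⟨k, q, hq, l, c, hc, (hcl hq hc).2 hsum⟩
  · rintro ⟨k, q, hq, l, c, hc, h⟩
    rw [(hcl hq hc).1 h, map_add, map_add, restriction_cl_smul_sq E hq hu hμ, WittGroup.add_self,
      zero_add]
    exact restriction_eq_zero_of_mem hu hμ hν (sum_mem fun i _ => binCl_div_mem hu v (hc i))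

end Main

end WittKernel

open Polynomial in
/-- for a mixed biquadratic extension `E = F(μ,ν)` of degree 4 in
characteristic 2 with `μ² = u`, `ν² + ν + v = 0`, setting `γ = μν` one has `E = F(γ)` with
minimal polynomial `f = X⁴ + uX² + u²v²` and cubic resolvent `f_C(X) = X³ + uX²`; in `W_qF`,
for `e ∈ F*` with `f_C(e) ≠ 0` and `r = uv/e`, one has
`⟨⟨f_C(e), u²v²/e²]] = ⟨1,u⟩_b ⊗ [1,r] + ⟨u, u(v+r)⟩_b ⊗ [1,v]`; consequently
`W_q(E/F) = ⟨1,u⟩_b ⊗ W_qF + WF ⊗ [1,v]`. -/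
theorem stmt_14 (F : Type) [Field F] [CharP F 2] (E : Type) [Field E] [Algebra F E]
    (u v : F) (hu : u ≠ 0) (hv : v ≠ 0) (μ ν : E)
    (hμ : μ ^ 2 = algebraMap F E u) (hν : ν ^ 2 + ν + algebraMap F E v = 0)
    (hdim : Module.finrank F E = 4)
    (hE : IntermediateField.adjoin F {μ, ν} = ⊤) :
    IntermediateField.adjoin F {μ * ν} = ⊤ ∧
    minpoly F (μ * ν) = X ^ 4 + C u * X ^ 2 + C (u ^ 2 * v ^ 2) ∧
    (∀ e : F, cubicResolvent F 0 u 0 (u ^ 2 * v ^ 2) e = e ^ 3 + u * e ^ 2) ∧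
    (∀ e : F, e ≠ 0 → cubicResolvent F 0 u 0 (u ^ 2 * v ^ 2) e ≠ 0 →
      WittEquiv F
        (pf2 F (cubicResolvent F 0 u 0 (u ^ 2 * v ^ 2) e) (u ^ 2 * v ^ 2 / e ^ 2))
        (oSum F
          (oSum F (binQF F 1 (u * v / e)) (u • binQF F 1 (u * v / e)))
          (oSum F (u • binQF F 1 v) ((u * (v + u * v / e)) • binQF F 1 v)))) ∧
    (∀ (N : ℕ) (φ : QF F N), Nonsingular F φ →
      (InWqKernel F E φ ↔
        ∃ (k : ℕ) (q : QF F k), Nonsingular F q ∧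
          ∃ (l : ℕ) (lam : Fin l → F), (∀ i, lam i ≠ 0) ∧
            WittEquiv F φ (oSum F (oSum F q (u • q))
              (oSumFam F fun i => lam i • binQF F 1 v)))) := by
  have : CharP E 2 := charP_of_injective_algebraMap (algebraMap F E).injective 2
  have hres : ∀ e : F, cubicResolvent F 0 u 0 (u ^ 2 * v ^ 2) e = e ^ 3 + u * e ^ 2 := fun e => by
    simp [cubicResolvent]
  refine ⟨WittKernel.adjoin_mul_eq_top hu hv hμ hν hE,
    WittKernel.minpoly_mul hu hv hμ hν hdim hE, hres, fun e he hg => ?_, fun N φ hφ => ?_⟩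
  · rw [hres] at hg ⊢
    exact WittKernel.wittEquiv_pfister_identity hu hv he hg
  · obtain ⟨b, hb⟩ := WittKernel.exists_basis hμ hν hdim hE
    exact WittKernel.inWqKernel_iff_exists hu hv hμ hν b hb hφ
end

section
/- Let F be a field of characteristic 2, let d ∈ F \ F², and consider the purely inseparable simple quartic extension E = F(⁴√d) with resolvent f_C(X) = X³. Let x ∈ F* and y ∈ F²(d)*, written y = u² + dv² with u, v ∈ F not both zero. Then in the Witt group W_qF the 2-fold quadratic Pfister form π = ⟨⟨x, dx²y²]] satisfies: if v = 0 then π = ⟨⟨f_C(s), d/s²]] with s = 1/(xu²); if u = 0 then π = ⟨⟨f_C(t), d/t²]] with t = 1/(dxv²); and if u ≠ 0 and v ≠ 0 then π = ⟨⟨f_C(s), d/s²]] + ⟨⟨f_C(t), d/t²]] with s = 1/(xu²) and t = 1/(dxv²). In particular, every generator ⟨⟨x, dx²y²]] of Ahmad's description of W_q(E/F) is a sum of at most two generators of type ⟨⟨f_C(e), d/e²]]. -/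
open QuadraticMap

variable (F : Type) [Field F]

/-- The value of the binary form `[a, b]`. -/
theorem binQF_apply {K : Type} [Field K] (a b : K) (p : Fin 2 → K) :
    binQF K a b p = a * (p 0 * p 0) + p 0 * p 1 + b * (p 1 * p 1) := by
  simp [binQF, Matrix.toQuadraticMap', Matrix.toQuadraticForm', LinearMap.BilinMap.toQuadraticMap_apply,
    Matrix.toLinearMap₂'_apply, Fin.sum_univ_two]
  ring

/-- `oSum` is the external orthogonal sum, up to isometry. -/
theorem oSum_equivalent_prod {K : Type} [Field K] {n m : ℕ} (q₁ : QF K n) (q₂ : QF K m) :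
    (oSum K q₁ q₂).Equivalent (q₁.prod q₂) :=
  ⟨{ toLinearEquiv := (LinearEquiv.funCongrLeft K K finSumFinEquiv).trans
        (LinearEquiv.sumArrowLequivProdArrow (Fin n) (Fin m) K K)
     map_app' := fun _ => rfl }⟩

/-- `oSumFam` is the external orthogonal sum of a family, up to isometry. -/
theorem oSumFam_equivalent_pi {K : Type} [Field K] {k n : ℕ} (q : Fin k → QF K n) :
    (oSumFam K q).Equivalent (QuadraticMap.pi q) :=
  ⟨{ toLinearEquiv := (LinearEquiv.funCongrLeft K K finProdFinEquiv).trans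
        (LinearEquiv.curry K K (Fin k) (Fin n))
     map_app' := fun _ => rfl }⟩

/-- Reassociation of an orthogonal sum. -/
theorem prod_assoc_equivalent {K M₁ M₂ M₃ : Type} [Field K]
    [AddCommGroup M₁] [Module K M₁] [AddCommGroup M₂] [Module K M₂] [AddCommGroup M₃] [Module K M₃]
    (q₁ : QuadraticForm K M₁) (q₂ : QuadraticForm K M₂) (q₃ : QuadraticForm K M₃) :
    ((q₁.prod q₂).prod q₃).Equivalent (q₁.prod (q₂.prod q₃)) :=
  ⟨{ toLinearEquiv := LinearEquiv.prodAssoc K M₁ M₂ M₃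
     map_app' := fun _ => (add_assoc _ _ _).symm }⟩

/-- Summing a constant family over `Fin (k + 1)` splits off one copy. -/
theorem oSumFam_succ_equivalent {K : Type} [Field K] {n : ℕ} (k : ℕ) (q : QF K n) :
    (q.prod (oSumFam K fun _ : Fin k => q)).Equivalent (oSumFam K fun _ : Fin (k + 1) => q) := by
  refine (QuadraticMap.Equivalent.prod (.refl q) (oSumFam_equivalent_pi _)).trans
    (QuadraticMap.Equivalent.trans ?_ (oSumFam_equivalent_pi _).symm)
  exact ⟨{ toLinearEquiv := Fin.consLinearEquiv K fun _ : Fin (k + 1) => Fin n → K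
           map_app' := fun p => by
            simp [QuadraticMap.pi_apply, Fin.sum_univ_succ, Fin.consLinearEquiv] }⟩

/-- A nonsingular isotropic form splits off a hyperbolic plane. -/
theorem exists_prod_hyperbolic_equivalent {K V : Type} [Field K] [AddCommGroup V] [Module K V]
    (Q : QuadraticForm K V) (hQ : Nonsingular K Q) (v : V) (hv : v ≠ 0) (hQv : Q v = 0) :
    ∃ W : Submodule K V, Nonsingular K (Q.restrict W) ∧
      ((binQF K 0 0).prod (Q.restrict W)).Equivalent Q := by
  obtain ⟨y, hy⟩ : ∃ y, polar Q v y ≠ 0 := by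
    by_contra! h
    exact hv (hQ v h)
  obtain ⟨w, hvw, hQw⟩ : ∃ w, polar Q v w = 1 ∧ Q w = 0 := by
    obtain ⟨w₀, h1⟩ : ∃ w₀, polar Q v w₀ = 1 :=
      ⟨(polar Q v y)⁻¹ • y, by rw [polar_smul_right, smul_eq_mul, inv_mul_cancel₀ hy]⟩
    refine ⟨w₀ + (-Q w₀) • v, ?_, ?_⟩
    · rw [polar_add_right, polar_smul_right, polar_self, h1, hQv]
      simp
    · rw [QuadraticMap.map_add Q, QuadraticMap.map_smul, polar_smul_right, polar_comm Q w₀ v, h1,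
        hQv]
      simp
  have hvv : polar Q v v = 0 := by rw [polar_self, hQv, smul_zero]
  have hww : polar Q w w = 0 := by rw [polar_self, hQw, smul_zero]
  have hwv : polar Q w v = 1 := by rw [polar_comm, hvw]
  let W : Submodule K V := LinearMap.ker (Q.polarBilin v) ⊓ LinearMap.ker (Q.polarBilin w)
  have hW : ∀ z, z ∈ W ↔ polar Q v z = 0 ∧ polar Q w z = 0 := fun z => by
    simp [W, Submodule.mem_inf]
  have hdec : ∀ y : V, y - polar Q w y • v - polar Q v y • w ∈ W := fun y => by
    rw [hW]
    simp [sub_eq_add_neg, ← neg_smul, polar_add_right, polar_smul_right, hvv, hww, hvw, hwv]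
  refine ⟨W, ?_, ?_⟩
  · rintro ⟨z, hz⟩ h
    have hz' := (hW z).1 hz
    refine Subtype.ext (hQ z fun y => ?_)
    have h0 := h ⟨_, hdec y⟩
    have h1 : polar Q z (y - polar Q w y • v - polar Q v y • w) = 0 := h0
    rw [sub_eq_add_neg, sub_eq_add_neg, ← neg_smul, ← neg_smul, polar_add_right, polar_add_right,
      polar_smul_right, polar_smul_right, polar_comm Q z v, polar_comm Q z w, hz'.1, hz'.2] at h1
    simpa using h1
  · let f : (Fin 2 → K) × W →ₗ[K] V :=
      LinearMap.coprod ((LinearMap.proj 0).smulRight v + (LinearMap.proj 1).smulRight w) W.subtype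
    have hf : ∀ p, f p = p.1 0 • v + p.1 1 • w + (p.2 : V) := fun p => rfl
    have hpv : ∀ p, polar Q v (f p) = p.1 1 := fun p => by
      rw [hf, polar_add_right, polar_add_right, polar_smul_right, polar_smul_right, hvv, hvw,
        ((hW _).1 p.2.2).1]
      simp
    have hpw : ∀ p, polar Q w (f p) = p.1 0 := fun p => by
      rw [hf, polar_add_right, polar_add_right, polar_smul_right, polar_smul_right, hww, hwv,
        ((hW _).1 p.2.2).2]
      simp
    have hbij : Function.Bijective f := by
      constructor
      · rw [← LinearMap.ker_eq_bot, LinearMap.ker_eq_bot']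
        intro p hp
        have h0 : p.1 0 = 0 := by rw [← hpw, hp, polar_zero_right]
        have h1 : p.1 1 = 0 := by rw [← hpv, hp, polar_zero_right]
        refine Prod.ext (funext fun i => ?_) (Subtype.ext ?_)
        · fin_cases i
          · exact h0
          · exact h1
        · simpa [hf, h0, h1] using hp
      · intro y
        refine ⟨(![polar Q w y, polar Q v y], ⟨_, hdec y⟩), ?_⟩
        simp [hf]
    refine ⟨{ toLinearEquiv := LinearEquiv.ofBijective f hbij, map_app' := fun p => ?_ }⟩
    change Q (f p) = binQF K 0 0 p.1 + Q (p.2 : V)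
    have hp := (hW _).1 p.2.2
    rw [hf, QuadraticMap.map_add Q, QuadraticMap.map_add Q, QuadraticMap.map_smul,
      QuadraticMap.map_smul, polar_add_left, polar_smul_left, polar_smul_left, polar_smul_left,
      polar_smul_right, hp.1, hp.2, hvw, hQv, hQw, binQF_apply]
    simp

/-- Witt decomposition of a nonsingular form. -/
theorem exists_witt_decomposition {K V : Type} [Field K] [AddCommGroup V]
    [Module K V] [FiniteDimensional K V] (Q : QuadraticForm K V) (hQ : Nonsingular K Q) :
    ∃ (i r : ℕ) (ρ : QF K r), ρ.Anisotropic ∧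
      Q.Equivalent ((oSumFam K fun _ : Fin i => binQF K 0 0).prod ρ) := by
  obtain ⟨n, hn⟩ : ∃ n, Module.finrank K V < n := ⟨_, Nat.lt_succ_self _⟩
  induction n generalizing V with
  | zero => omega
  | succ n ih =>
    by_cases hani : Q.Anisotropic
    · let e := (Module.finBasis K V).equivFun
      refine ⟨0, Module.finrank K V, Q.comp e.symm.toLinearMap, fun p hp => ?_, ⟨?_⟩⟩
      · simpa using hani _ hp
      · have : IsEmpty (Fin (0 * 2)) := by rw [Nat.zero_mul]; infer_instance
        exact QuadraticMap.IsometryEquiv.symm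
          { toLinearEquiv := LinearEquiv.uniqueProd.trans e.symm
            map_app' := fun p => by
              simp [Subsingleton.elim p.1 0] }
    · obtain ⟨v, hv, hv0⟩ : ∃ v, Q v = 0 ∧ v ≠ 0 := by
        simpa [QuadraticMap.Anisotropic] using hani
      obtain ⟨W, hW, ⟨e⟩⟩ := exists_prod_hyperbolic_equivalent Q hQ v hv0 hv
      have hdim := e.toLinearEquiv.finrank_eq
      rw [Module.finrank_prod, Module.finrank_fin_fun] at hdim
      obtain ⟨i, r, ρ, hρ, h⟩ := ih (Q.restrict W) hW (by omega)
      exact ⟨i + 1, r, ρ, hρ, (QuadraticMap.Equivalent.symm ⟨e⟩).trans <|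
        (QuadraticMap.Equivalent.prod (.refl _) h).trans <|
        (prod_assoc_equivalent _ _ _).symm.trans <|
        (oSumFam_succ_equivalent _ _).prod (.refl _)⟩

/-- Adding the zero-dimensional zero form does not change the isometry class. -/
theorem oSum_diagQF_zero_equivalent {K : Type} [Field K] {n : ℕ} (q : QF K n) :
    (oSum K q (diagQF K (0 : Fin 0 → K))).Equivalent q := by
  refine (oSum_equivalent_prod _ _).trans ⟨?_⟩
  exact
    { toLinearEquiv := LinearEquiv.prodUnique (R := K)
      map_app' := fun p => by simp [diagQF, QuadraticMap.weightedSumSquares_apply] }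

/-- A form isometric to a form Witt equivalent to `Q` is Witt equivalent to `Q`. -/
theorem WittEquiv.of_equivalent_left {K M N P : Type} [Field K] [AddCommGroup M] [Module K M]
    [AddCommGroup N] [Module K N] [AddCommGroup P] [Module K P] {q' : QuadraticForm K P}
    {q : QuadraticForm K M} {Q : QuadraticForm K N} (h : WittEquiv K q Q) (e : q'.Equivalent q) :
    WittEquiv K q' Q := by
  obtain ⟨r, ρ, hρ, ⟨i, j, hq⟩, hQ⟩ := h
  exact ⟨r, ρ, hρ, ⟨i, j, e.trans hq⟩, hQ⟩

/-- Witt equivalence is symmetric. -/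
theorem WittEquiv.symm {K M N : Type} [Field K] [AddCommGroup M] [Module K M]
    [AddCommGroup N] [Module K N] {q : QuadraticForm K M} {Q : QuadraticForm K N}
    (h : WittEquiv K q Q) : WittEquiv K Q q := by
  obtain ⟨r, ρ, hρ, hq, hQ⟩ := h
  exact ⟨r, ρ, hρ, hQ, hq⟩

/-- Adding a hyperbolic plane preserves Witt equivalence. -/
theorem WittEquiv.hyperbolic_prod {K M N : Type} [Field K] [AddCommGroup M] [Module K M]
    [AddCommGroup N] [Module K N] {q : QuadraticForm K M} {Q : QuadraticForm K N}
    (h : WittEquiv K q Q) : WittEquiv K ((binQF K 0 0).prod q) Q := by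
  obtain ⟨r, ρ, hρ, ⟨i, j, hq⟩, hQ⟩ := h
  refine ⟨r, ρ, hρ, ⟨i + 1, j, ?_⟩, hQ⟩
  refine (QuadraticMap.Equivalent.prod (.refl _) hq).trans ?_
  refine QuadraticMap.Equivalent.trans ?_ (oSum_equivalent_prod _ _).symm
  refine (QuadraticMap.Equivalent.prod (.refl _) (oSum_equivalent_prod _ _)).trans ?_
  refine (prod_assoc_equivalent _ _ _).symm.trans (QuadraticMap.Equivalent.prod ?_ (.refl _))
  refine (QuadraticMap.Equivalent.prod (.refl _) (oSum_equivalent_prod _ _)).trans ?_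
  refine QuadraticMap.Equivalent.trans ?_ (oSum_equivalent_prod _ _).symm
  exact (prod_assoc_equivalent _ _ _).symm.trans ((oSumFam_succ_equivalent _ _).prod (.refl _))

/-- A nonsingular form is Witt equivalent to itself. -/
theorem WittEquiv.refl {K M : Type} [Field K] [AddCommGroup M] [Module K M]
    [FiniteDimensional K M] (q : QuadraticForm K M) (hq : Nonsingular K q) : WittEquiv K q q := by
  obtain ⟨i, r, ρ, hρ, h⟩ := exists_witt_decomposition q hq
  have h' := (h.trans (oSum_equivalent_prod _ _).symm).trans (oSum_diagQF_zero_equivalent _).symm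
  exact ⟨r, ρ, hρ, ⟨i, 0, h'⟩, ⟨i, 0, h'⟩⟩

/-- An orthogonal sum of nonsingular forms is nonsingular. -/
theorem Nonsingular.prod {K M N : Type} [Field K] [AddCommGroup M] [Module K M]
    [AddCommGroup N] [Module K N] {q : QuadraticForm K M} {Q : QuadraticForm K N}
    (hq : Nonsingular K q) (hQ : Nonsingular K Q) : Nonsingular K (q.prod Q) := by
  intro p h
  refine Prod.ext (hq _ fun y => ?_) (hQ _ fun y => ?_)
  · simpa [polar_prod] using h (y, 0)
  · simpa [polar_prod] using h (0, y)

/-- In characteristic 2, every nonzero multiple of `[a, b]` is nonsingular. -/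
theorem nonsingular_smul_binQF {K : Type} [Field K] [CharP K 2] {g : K} (hg : g ≠ 0) (a b : K) :
    Nonsingular K (g • binQF K a b) := by
  have h2 : (2 : K) = 0 := CharTwo.two_eq_zero
  intro p h
  have key : ∀ y, polar (g • binQF K a b) p y = g * (p 0 * y 1 + p 1 * y 0) := fun y => by
    simp only [polar, smul_apply, binQF_apply, Pi.add_apply, smul_eq_mul]
    linear_combination g * (a * p 0 * y 0 + b * p 1 * y 1) * h2
  funext i
  fin_cases i
  · simpa [hg] using (key ![0, 1]).symm.trans (h _)
  · simpa [hg] using (key ![1, 0]).symm.trans (h _)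

/-- Scaling `[1, h]` by a nonzero square does not change its isometry class. -/
theorem smul_mul_sq_binQF_equivalent {K : Type} [Field K] (g h : K) {c : K} (hc : c ≠ 0) :
    ((g * c ^ 2) • binQF K 1 h).Equivalent (g • binQF K 1 h) :=
  ⟨{ toLinearEquiv := LinearEquiv.smulOfNeZero K (Fin 2 → K) c hc
     map_app' := fun p => by
      simp [binQF_apply]
      ring }⟩

/-- The norm form `[1, h]` is similar to itself with factor its value `h`. -/
theorem smul_mul_value_binQF_equivalent {K : Type} [Field K] [CharP K 2] (g : K) {h : K}
    (hh : h ≠ 0) : ((g * h) • binQF K 1 h).Equivalent (g • binQF K 1 h) := by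
  have h2 : (2 : K) = 0 := CharTwo.two_eq_zero
  exact
    ⟨{ toFun := fun p => ![h * p 1, p 0 + p 1]
       invFun := fun p => ![p 1 - h⁻¹ * p 0, h⁻¹ * p 0]
       map_add' := fun p q => by
        funext i
        fin_cases i <;> simp <;> ring
       map_smul' := fun c p => by
        funext i
        fin_cases i <;> simp <;> ring
       left_inv := fun p => by
        funext i
        fin_cases i <;> simp [hh]
       right_inv := fun p => by
        funext i
        fin_cases i <;> simp [hh]
       map_app' := fun p => by
        simp [binQF_apply]
        linear_combination g * h * (p 1 * p 1 + p 0 * p 1) * h2 }⟩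

/-- In characteristic 2, `x[1, a] ⊥ x[1, b]` is isometric to `ℍ ⊥ x[1, a + b]`. -/
theorem smul_binQF_prod_equivalent {K : Type} [Field K] [CharP K 2] {x : K} (hx : x ≠ 0)
    (a b : K) :
    ((x • binQF K 1 a).prod (x • binQF K 1 b)).Equivalent
      ((binQF K 0 0).prod (x • binQF K 1 (a + b))) := by
  have h2 : (2 : K) = 0 := CharTwo.two_eq_zero
  exact QuadraticMap.Equivalent.symm
    ⟨{ toFun := fun p =>
        (![x⁻¹ * p.1 0 + b * p.1 1 + p.2 0, p.2 1], ![x⁻¹ * p.1 0 + b * p.1 1, p.1 1 + p.2 1])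
       invFun := fun p =>
        (![x * (p.2 0 - b * (p.2 1 - p.1 1)), p.2 1 - p.1 1], ![p.1 0 - p.2 0, p.1 1])
       map_add' := fun p q => by
        refine Prod.ext (funext fun i => ?_) (funext fun i => ?_) <;>
          fin_cases i <;> simp <;> ring
       map_smul' := fun c p => by
        refine Prod.ext (funext fun i => ?_) (funext fun i => ?_) <;>
          fin_cases i <;> simp <;> ring
       left_inv := fun p => by
        refine Prod.ext (funext fun i => ?_) (funext fun i => ?_) <;>
          fin_cases i <;> simp [hx]
       right_inv := fun p => by
        refine Prod.ext (funext fun i => ?_) (funext fun i => ?_) <;>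
          fin_cases i <;> simp [hx]
       map_app' := fun p => by
        simp [binQF_apply]
        linear_combination x * ((x⁻¹ * p.1 0 + b * p.1 1) ^ 2 +
          (x⁻¹ * p.1 0 + b * p.1 1) * (p.2 0 + p.2 1) + b * p.1 1 ^ 2 + b * p.1 1 * p.2 1) * h2 +
          p.1 0 * p.1 1 * mul_inv_cancel₀ hx }⟩

/-- In characteristic 2, `⟨⟨g', h]]` and `⟨⟨g, h]]` are Witt equivalent when `g'[1, h] ≅ g[1, h]`. -/
theorem wittEquiv_pf2 {K : Type} [Field K] [CharP K 2] {g g' : K} (hg : g ≠ 0) (h : K)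
    (e : (g' • binQF K 1 h).Equivalent (g • binQF K 1 h)) :
    WittEquiv K (pf2 K g' h) (pf2 K g h) := by
  have hn : Nonsingular K ((binQF K 1 h).prod (g • binQF K 1 h)) :=
    (by simpa using nonsingular_smul_binQF one_ne_zero 1 h : Nonsingular K (binQF K 1 h)).prod
      (nonsingular_smul_binQF hg 1 h)
  have e' := (oSum_equivalent_prod (binQF K 1 h) (g' • binQF K 1 h)).trans (.prod (.refl _) e)
  exact (((WittEquiv.refl _ hn).of_equivalent_left e').symm.of_equivalent_left
    (oSum_equivalent_prod _ _)).symm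

/-- In characteristic 2, `⟨⟨x, a + b]] = ⟨⟨g, a]] + ⟨⟨g', b]]` in the Witt group when
`g[1, a] ≅ x[1, a]` and `g'[1, b] ≅ x[1, b]`. -/
theorem wittEquiv_pf2_add {K : Type} [Field K] [CharP K 2] {x g g' : K} (hx : x ≠ 0) {a b : K}
    (ea : (g • binQF K 1 a).Equivalent (x • binQF K 1 a))
    (eb : (g' • binQF K 1 b).Equivalent (x • binQF K 1 b)) :
    WittEquiv K (pf2 K x (a + b)) (oSum K (pf2 K g a) (pf2 K g' b)) := by
  refine (WittEquiv.of_equivalent_left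
    (wittEquiv_pf2 hx (a + b) (.refl _)).hyperbolic_prod.hyperbolic_prod ?_).symm
  have e₁ : ((binQF K 1 a).prod (binQF K 1 b)).Equivalent
      ((binQF K 0 0).prod (binQF K 1 (a + b))) := by
    simpa only [one_smul] using smul_binQF_prod_equivalent one_ne_zero a b
  refine (oSum_equivalent_prod _ _).trans ?_
  refine (QuadraticMap.Equivalent.prod (oSum_equivalent_prod _ _)
    (oSum_equivalent_prod _ _)).trans ?_
  refine (QuadraticMap.Equivalent.prod (.prod (.refl _) ea) (.prod (.refl _) eb)).trans ?_
  refine QuadraticMap.Equivalent.trans ⟨.prodProdProdComm _ _ _ _⟩ ?_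
  refine (QuadraticMap.Equivalent.prod e₁ (smul_binQF_prod_equivalent hx a b)).trans ?_
  refine QuadraticMap.Equivalent.trans ⟨.prodProdProdComm _ _ _ _⟩ ?_
  refine (prod_assoc_equivalent _ _ _).trans ?_
  exact .prod (.refl _) (.prod (.refl _) (oSum_equivalent_prod _ _).symm)

/-- let `E = F(⁴√d)` be the purely inseparable simple quartic extension of a
field of characteristic 2 (`d ∈ F \ F²`), with cubic resolvent `f_C(X) = X³`.  For `x ∈ F*`
and `y = u² + dv² ∈ F²(d)*`, the 2-fold Pfister form `π = ⟨⟨x, dx²y²]]` satisfies, in `W_qF`: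
if `v = 0` then `π = ⟨⟨f_C(s), d/s²]]` with `s = 1/(xu²)`; if `u = 0` then
`π = ⟨⟨f_C(t), d/t²]]` with `t = 1/(dxv²)`; and if `u ≠ 0 ≠ v` then
`π = ⟨⟨f_C(s), d/s²]] + ⟨⟨f_C(t), d/t²]]`.  In particular, each generator `⟨⟨x, dx²y²]]` of
Ahmad's description of `W_q(E/F)` is a sum of at most two generators of type
`⟨⟨f_C(e), d/e²]]`. -/
theorem stmt_15 (F : Type) [Field F] [CharP F 2] (E : Type) [Field E] [Algebra F E]
    (d : F) (hd : ∀ r : F, r ^ 2 ≠ d) (α : E)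
    (hα : α ^ 4 = algebraMap F E d)
    (hdim : Module.finrank F E = 4)
    (hE : IntermediateField.adjoin F {α} = ⊤)
    (x : F) (hx : x ≠ 0) (u v : F) (huv : ¬(u = 0 ∧ v = 0)) :
    (v = 0 →
      WittEquiv F (pf2 F x (d * x ^ 2 * (u ^ 2 + d * v ^ 2) ^ 2))
        (pf2 F (cubicResolvent F 0 0 0 d (1 / (x * u ^ 2))) (d / (1 / (x * u ^ 2)) ^ 2))) ∧
    (u = 0 →
      WittEquiv F (pf2 F x (d * x ^ 2 * (u ^ 2 + d * v ^ 2) ^ 2))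
        (pf2 F (cubicResolvent F 0 0 0 d (1 / (d * x * v ^ 2)))
          (d / (1 / (d * x * v ^ 2)) ^ 2))) ∧
    (u ≠ 0 → v ≠ 0 →
      WittEquiv F (pf2 F x (d * x ^ 2 * (u ^ 2 + d * v ^ 2) ^ 2))
        (oSum F
          (pf2 F (cubicResolvent F 0 0 0 d (1 / (x * u ^ 2))) (d / (1 / (x * u ^ 2)) ^ 2))
          (pf2 F (cubicResolvent F 0 0 0 d (1 / (d * x * v ^ 2)))
            (d / (1 / (d * x * v ^ 2)) ^ 2)))) := by
  have hd0 : d ≠ 0 := fun h => hd 0 (by simp [h])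
  have hs : u ≠ 0 → ((cubicResolvent F 0 0 0 d (1 / (x * u ^ 2))) •
      binQF F 1 (d * x ^ 2 * u ^ 4)).Equivalent (x • binQF F 1 (d * x ^ 2 * u ^ 4)) := by
    intro hu
    have h1 : cubicResolvent F 0 0 0 d (1 / (x * u ^ 2)) = x * (1 / (x ^ 2 * u ^ 3)) ^ 2 := by
      simp only [cubicResolvent]
      field_simp
      ring
    rw [h1]
    exact smul_mul_sq_binQF_equivalent _ _ (by simp [hx, hu])
  have ht : v ≠ 0 → ((cubicResolvent F 0 0 0 d (1 / (d * x * v ^ 2))) •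
      binQF F 1 (d ^ 3 * x ^ 2 * v ^ 4)).Equivalent (x • binQF F 1 (d ^ 3 * x ^ 2 * v ^ 4)) := by
    intro hv
    have h1 : cubicResolvent F 0 0 0 d (1 / (d * x * v ^ 2)) =
        x * (d ^ 3 * x ^ 2 * v ^ 4) * (1 / (d ^ 3 * x ^ 3 * v ^ 5)) ^ 2 := by
      simp only [cubicResolvent]
      field_simp
      ring
    rw [h1]
    exact (smul_mul_sq_binQF_equivalent _ _ (by simp [hx, hd0, hv])).trans
      (smul_mul_value_binQF_equivalent _ (by simp [hx, hd0, hv]))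
  have hds : d / (1 / (x * u ^ 2)) ^ 2 = d * x ^ 2 * u ^ 4 := by
    rw [one_div, inv_pow, div_inv_eq_mul]
    ring
  have hdt : d / (1 / (d * x * v ^ 2)) ^ 2 = d ^ 3 * x ^ 2 * v ^ 4 := by
    rw [one_div, inv_pow, div_inv_eq_mul]
    ring
  have hsum : d * x ^ 2 * (u ^ 2 + d * v ^ 2) ^ 2 =
      d * x ^ 2 * u ^ 4 + d ^ 3 * x ^ 2 * v ^ 4 := by
    rw [CharTwo.add_sq]
    ring
  rw [hds, hdt, hsum]
  refine ⟨fun hv => ?_, fun hu => ?_, fun hu hv => wittEquiv_pf2_add hx (hs hu) (ht hv)⟩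
  · have hh : d * x ^ 2 * u ^ 4 + d ^ 3 * x ^ 2 * v ^ 4 = d * x ^ 2 * u ^ 4 := by simp [hv]
    rw [hh]
    exact (wittEquiv_pf2 hx _ (hs fun hu => huv ⟨hu, hv⟩)).symm
  · have hh : d * x ^ 2 * u ^ 4 + d ^ 3 * x ^ 2 * v ^ 4 = d ^ 3 * x ^ 2 * v ^ 4 := by simp [hu]
    rw [hh]
    exact (wittEquiv_pf2 hx _ (ht fun hv => huv ⟨hu, hv⟩)).symm
end

section
/- Let F be a field of characteristic 2 and let E = F(α) be a degree 4 extension where the minimal polynomial of α is f(X) = X⁴ + bX² + d with b ≠ 0 (so E/F is inseparable but not purely inseparable). Then the following are equivalent: (1) [F(√b,√d):F] = 2; (2) E contains an inseparable quadratic subextension F(√c) for some c ∈ F \ F², and in that case E = F(√c, α²) is mixed biquadratic; (3) the totally singular quadratic form ⟨1,b,d⟩ is isotropic over F, i.e. x² + by² + dz² = 0 has a nontrivial solution (x,y,z) ≠ (0,0,0) in F. -/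
section CharTwo

open IntermediateField

variable {F K : Type*} [Field F] [Field K] [Algebra F K]

/-- Adjoining a square root of a nonsquare gives a quadratic extension, and nothing changes when
an element of that extension is adjoined as well. -/
lemma finrank_adjoin_pair_of_sq_eq {c : F} (hc : ∀ r : F, r ^ 2 ≠ c) {s t : K}
    (hs : s ^ 2 = algebraMap F K c) (ht : t ∈ F⟮s⟯) :
    Module.finrank F (adjoin F {s, t}) = 2 := by
  have heq : adjoin F {s, t} = F⟮s⟯ := by
    apply le_antisymm
    · rw [adjoin_le_iff]
      rintro x (rfl | rfl)
      · exact mem_adjoin_simple_self F x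
      · exact ht
    · exact adjoin.mono F _ _ (by simp)
  have hirr : Irreducible (Polynomial.X ^ 2 - Polynomial.C c) :=
    X_pow_sub_C_irreducible_of_prime Nat.prime_two hc
  have hmin : Polynomial.X ^ 2 - Polynomial.C c = minpoly F s :=
    minpoly.eq_of_irreducible_of_monic hirr (by simp [hs])
      (Polynomial.monic_X_pow_sub_C c two_ne_zero)
  have hint : IsIntegral F s :=
    ⟨_, Polynomial.monic_X_pow_sub_C c two_ne_zero, by simp [hs]⟩
  rw [heq, adjoin.finrank hint, ← hmin, Polynomial.natDegree_X_pow_sub_C]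

variable [CharP F 2]

/-- Square roots are unique in characteristic 2. -/
lemma eq_of_sq_eq_sq_of_charTwo {x y : F} (h : x ^ 2 = y ^ 2) : x = y := by
  have h2 : (2 : F) = 0 := CharTwo.two_eq_zero
  have h0 : (x - y) ^ 2 = 0 := by linear_combination h + (y ^ 2 - x * y) * h2
  exact sub_eq_zero.mp (pow_eq_zero_iff two_ne_zero |>.mp h0)

/-- If `b = s²` and `d = t²` are not both squares in `F`, then `[F(s, t) : F] = 2` exactly when the
totally singular form `⟨1, b, d⟩` is isotropic. -/
lemma finrank_adjoin_sqrt_pair_eq_two_iff {b d : F}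
    (hbd : ∀ r q : F, ¬(r ^ 2 = b ∧ q ^ 2 = d)) {s t : K}
    (hs : s ^ 2 = algebraMap F K b) (ht : t ^ 2 = algebraMap F K d) :
    Module.finrank F (adjoin F {s, t}) = 2 ↔
      ∃ x y z : F, ¬(x = 0 ∧ y = 0 ∧ z = 0) ∧ x ^ 2 + b * y ^ 2 + d * z ^ 2 = 0 := by
  have : CharP K 2 := charP_of_injective_algebraMap (algebraMap F K).injective 2
  have h2 : (2 : K) = 0 := CharTwo.two_eq_zero
  have hinj := (algebraMap F K).injective
  constructor
  · intro hfin
    have hfd : FiniteDimensional F (adjoin F {s, t}) :=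
      Module.finite_of_finrank_pos (by omega)
    let v : Fin 3 → adjoin F {s, t} :=
      ![1, ⟨s, subset_adjoin F _ (by simp)⟩, ⟨t, subset_adjoin F _ (by simp)⟩]
    have hdep : ¬LinearIndependent F v := fun h => by
      have := h.fintype_card_le_finrank
      simp [hfin] at this
    obtain ⟨g, hg, i, hi⟩ := Fintype.not_linearIndependent_iff.mp hdep
    refine ⟨g 0, g 1, g 2, ?_, hinj ?_⟩
    · rintro ⟨h0, h1, h2⟩
      fin_cases i <;> simp_all
    · have hg' := congrArg (algebraMap (adjoin F {s, t}) K) hg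
      simp only [v, Fin.sum_univ_three, Algebra.smul_def, map_add, map_mul,
        ← IsScalarTower.algebraMap_apply, Matrix.cons_val, map_zero, mul_one,
        IntermediateField.algebraMap_apply] at hg'
      simp only [map_add, map_mul, map_pow, map_zero, ← hs, ← ht]
      generalize algebraMap F K (g 0) = x at *
      generalize algebraMap F K (g 1) = y at *
      generalize algebraMap F K (g 2) = z at *
      linear_combination (x + y * s + z * t) * hg' -
        (x * y * s + x * z * t + y * s * z * t) * h2
  · rintro ⟨x, y, z, hne, h⟩
    have hrel : algebraMap F K x + algebraMap F K y * s + algebraMap F K z * t = 0 := by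
      have h' := congrArg (algebraMap F K) h
      simp only [map_add, map_mul, map_pow, map_zero, ← hs, ← ht] at h'
      apply pow_eq_zero_iff two_ne_zero |>.mp
      generalize algebraMap F K x = x at *
      generalize algebraMap F K y = y at *
      generalize algebraMap F K z = z at *
      linear_combination h' + (x * y * s + x * z * t + y * s * z * t) * h2
    by_cases hz : z = 0
    · have hy : y ≠ 0 := by
        rintro rfl
        simp_all
      have hy' : algebraMap F K y ≠ 0 := by simpa using hy
      have hsx : s = algebraMap F K (-x / y) := by
        simp only [hz, map_zero, zero_mul, add_zero] at hrel
        simp only [map_div₀, map_neg]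
        field_simp
        linear_combination hrel
      rw [Set.pair_comm]
      refine finrank_adjoin_pair_of_sq_eq (fun q hq => hbd (-x / y) q ⟨hinj ?_, hq⟩) ht ?_
      · rw [map_pow, ← hsx, hs]
      · rw [hsx]
        exact IntermediateField.algebraMap_mem _ _
    · have hz' : algebraMap F K z ≠ 0 := by simpa using hz
      have htx : t = algebraMap F K (-x / z) + algebraMap F K (-y / z) * s := by
        simp only [map_div₀, map_neg]
        field_simp
        linear_combination hrel
      refine finrank_adjoin_pair_of_sq_eq
        (fun r hr => hbd r (-x / z + -y / z * r) ⟨hr, hinj ?_⟩) hs ?_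
      · have hsr : s = algebraMap F K r :=
          eq_of_sq_eq_sq_of_charTwo (by rw [hs, ← hr, map_pow])
        rw [← ht, htx, hsr]
        simp only [map_add, map_mul, map_pow]
      · rw [htx]
        exact add_mem (IntermediateField.algebraMap_mem _ _)
          (mul_mem (IntermediateField.algebraMap_mem _ _) (mem_adjoin_simple_self F s))

/-- In characteristic 2, the set of square roots of `b` and of `d` is determined by any choice of
roots. -/
lemma setOf_sq_eq_or_sq_eq_of_charTwo {b d s t : F} (hs : s ^ 2 = b) (ht : t ^ 2 = d) :
    {x : F | x ^ 2 = b ∨ x ^ 2 = d} = {s, t} := by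
  ext x
  subst hs ht
  constructor
  · rintro (h | h)
    · exact Or.inl (eq_of_sq_eq_sq_of_charTwo h)
    · exact Or.inr (eq_of_sq_eq_sq_of_charTwo h)
  · rintro (rfl | rfl) <;> simp

end CharTwo

section Quartic

open IntermediateField

variable {F E : Type*} [Field F] [Field E] [Algebra F E] {α : E}

/-- The powers `1, α, α², α³` of a generator of a quartic extension are linearly independent. -/
lemma linearIndependent_pow_fin_four (hdim : Module.finrank F E = 4) (hE : F⟮α⟯ = ⊤) :
    LinearIndependent F (fun i : Fin 4 => α ^ (i : ℕ)) := by
  have : FiniteDimensional F E := Module.finite_of_finrank_pos (by omega)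
  have hdeg : (minpoly F α).natDegree = 4 := by
    rw [← adjoin.finrank (IsIntegral.of_finite F α), hE, finrank_top', hdim]
  have h := linearIndependent_pow (K := F) α
  rwa [hdeg] at h

/-- A cubic polynomial relation satisfied by a generator of a quartic extension is trivial. -/
lemma coeffs_eq_zero_of_cubic_eq_zero (hdim : Module.finrank F E = 4) (hE : F⟮α⟯ = ⊤)
    {p q r s : F} (h : algebraMap F E p + algebraMap F E q * α + algebraMap F E r * α ^ 2 +
      algebraMap F E s * α ^ 3 = 0) : p = 0 ∧ q = 0 ∧ r = 0 ∧ s = 0 := by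
  have hli := linearIndependent_pow_fin_four hdim hE
  rw [Fintype.linearIndependent_iff] at hli
  replace hli := hli ![p, q, r, s] (by simpa [Fin.sum_univ_four, Algebra.smul_def] using h)
  exact ⟨by simpa using hli 0, by simpa using hli 1, by simpa using hli 2, by simpa using hli 3⟩

/-- Every element of a quartic extension is a cubic polynomial in a given generator. -/
lemma exists_eq_cubic (hdim : Module.finrank F E = 4) (hE : F⟮α⟯ = ⊤) (β : E) :
    ∃ p q r s : F, β = algebraMap F E p + algebraMap F E q * α + algebraMap F E r * α ^ 2 +
      algebraMap F E s * α ^ 3 := by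
  have : FiniteDimensional F E := Module.finite_of_finrank_pos (by omega)
  have hspan := (linearIndependent_pow_fin_four hdim hE).span_eq_top_of_card_eq_finrank'
    (by simp [hdim])
  have hβ : β ∈ Submodule.span F (Set.range fun i : Fin 4 => α ^ (i : ℕ)) := by
    rw [hspan]
    trivial
  obtain ⟨c, hc⟩ := (Submodule.mem_span_range_iff_exists_fun F).mp hβ
  exact ⟨c 0, c 1, c 2, c 3, by simpa [Fin.sum_univ_four, Algebra.smul_def] using hc.symm⟩

variable [CharP F 2] {b d : F}

/-- If `X⁴ + bX² + d` is the minimal polynomial of a generator, `b` and `d` are not both squares. -/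
lemma not_both_squares (hα : α ^ 4 + algebraMap F E b * α ^ 2 + algebraMap F E d = 0)
    (hdim : Module.finrank F E = 4) (hE : F⟮α⟯ = ⊤) (r q : F) : ¬(r ^ 2 = b ∧ q ^ 2 = d) := by
  have : CharP E 2 := charP_of_injective_algebraMap (algebraMap F E).injective 2
  have h2 : (2 : E) = 0 := CharTwo.two_eq_zero
  rintro ⟨rfl, rfl⟩
  have hsq : (algebraMap F E q + algebraMap F E r * α + α ^ 2) ^ 2 = 0 := by
    simp only [map_pow] at hα
    generalize algebraMap F E r = r at *
    generalize algebraMap F E q = q at *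
    linear_combination hα + (q * r * α + q * α ^ 2 + r * α ^ 3) * h2
  have h0 := pow_eq_zero_iff two_ne_zero |>.mp hsq
  have := coeffs_eq_zero_of_cubic_eq_zero hdim hE (p := q) (q := r) (r := 1) (s := 0)
    (by simpa using h0)
  exact one_ne_zero this.2.2.1

/-- An inseparable quadratic subextension of `F(α)` forces `⟨1, b, d⟩` to be isotropic. -/
lemma isotropic_of_exists_sqrt
    (hα : α ^ 4 + algebraMap F E b * α ^ 2 + algebraMap F E d = 0)
    (hdim : Module.finrank F E = 4) (hE : F⟮α⟯ = ⊤) {c : F} (hc : ∀ r : F, r ^ 2 ≠ c) {β : E}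
    (hβ : β ^ 2 = algebraMap F E c) :
    ∃ x y z : F, ¬(x = 0 ∧ y = 0 ∧ z = 0) ∧ x ^ 2 + b * y ^ 2 + d * z ^ 2 = 0 := by
  have : CharP E 2 := charP_of_injective_algebraMap (algebraMap F E).injective 2
  have h2 : (2 : E) = 0 := CharTwo.two_eq_zero
  have h2' : (2 : F) = 0 := CharTwo.two_eq_zero
  obtain ⟨p, q, r, s, rfl⟩ := exists_eq_cubic hdim hE β
  have hcoeff := coeffs_eq_zero_of_cubic_eq_zero hdim hE
    (p := p ^ 2 + d * r ^ 2 + b * d * s ^ 2 + c) (q := 0)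
    (r := b * r ^ 2 + q ^ 2 + s ^ 2 * (b ^ 2 + d)) (s := 0) (by
      simp only [map_add, map_mul, map_pow, map_zero]
      generalize algebraMap F E p = p at *
      generalize algebraMap F E q = q at *
      generalize algebraMap F E r = r at *
      generalize algebraMap F E s = s at *
      generalize algebraMap F E b = b at *
      generalize algebraMap F E d = d at *
      generalize algebraMap F E c = c at *
      linear_combination hβ - (r ^ 2 + s ^ 2 * (α ^ 2 - b)) * hα +
        (c + d * r ^ 2 + b * r ^ 2 * α ^ 2 + s ^ 2 * d * α ^ 2 - p * q * α
          - p * r * α ^ 2 - p * s * α ^ 3 - q * r * α ^ 3 - q * s * α ^ 4 - r * s * α ^ 5) * h2)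
  refine ⟨q + b * s, r, s, ?_, ?_⟩
  · rintro ⟨hq, rfl, rfl⟩
    simp only [mul_zero, add_zero] at hq
    subst hq
    exact hc p ((algebraMap F E).injective (by simpa using hβ))
  · linear_combination hcoeff.2.2.1 + q * b * s * h2'

/-- If `⟨1, b, d⟩` is isotropic, then `F(α) = F(√c, α²)` for some nonsquare `c` of `F`. -/
lemma exists_sqrt_of_isotropic (hb : b ≠ 0)
    (hα : α ^ 4 + algebraMap F E b * α ^ 2 + algebraMap F E d = 0)
    (hdim : Module.finrank F E = 4) (hE : F⟮α⟯ = ⊤) {x y z : F}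
    (hne : ¬(x = 0 ∧ y = 0 ∧ z = 0)) (h : x ^ 2 + b * y ^ 2 + d * z ^ 2 = 0) :
    ∃ c : F, (∀ r : F, r ^ 2 ≠ c) ∧ ∃ β : E, β ^ 2 = algebraMap F E c ∧
      adjoin F {β, α ^ 2} = ⊤ := by
  have : CharP E 2 := charP_of_injective_algebraMap (algebraMap F E).injective 2
  have h2 : (2 : E) = 0 := CharTwo.two_eq_zero
  set β : E := algebraMap F E (x + b * z) * α + algebraMap F E y * α ^ 2 +
    algebraMap F E z * α ^ 3 with hβdef
  have hβ : β ^ 2 = algebraMap F E (d * y ^ 2 + b * d * z ^ 2) := by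
    have h' := congrArg (algebraMap F E) h
    simp only [map_add, map_mul, map_pow, map_zero] at h' ⊢
    rw [hβdef]
    simp only [map_add, map_mul]
    generalize algebraMap F E x = x at *
    generalize algebraMap F E y = y at *
    generalize algebraMap F E z = z at *
    generalize algebraMap F E b = b at *
    generalize algebraMap F E d = d at *
    linear_combination (y ^ 2 + z ^ 2 * (α ^ 2 - b)) * hα + α ^ 2 * h' +
      ((x + b * z) * y * α ^ 3 + (x + b * z) * z * α ^ 4 + y * z * α ^ 5
        + x * b * z * α ^ 2 + b ^ 2 * z ^ 2 * α ^ 2 - b * y ^ 2 * α ^ 2 - d * z ^ 2 * α ^ 2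
        - d * y ^ 2) * h2
  refine ⟨_, fun r hr => ?_, β, hβ, ?_⟩
  · have hβr : β = algebraMap F E r := eq_of_sq_eq_sq_of_charTwo (by rw [hβ, ← hr, map_pow])
    obtain ⟨-, h1, rfl, rfl⟩ := coeffs_eq_zero_of_cubic_eq_zero hdim hE
      (p := -r) (q := x + b * z) (r := y) (s := z) (by
        rw [map_neg]
        linear_combination hβr)
    exact hne ⟨by simpa using h1, rfl, rfl⟩
  · have hv : algebraMap F E (x + b * z) + algebraMap F E z * α ^ 2 ≠ 0 := by
      intro hv
      obtain ⟨h1, -, rfl, -⟩ := coeffs_eq_zero_of_cubic_eq_zero hdim hE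
        (p := x + b * z) (q := 0) (r := z) (s := 0) (by simpa using hv)
      simp only [mul_zero, add_zero] at h1
      subst h1
      exact hne ⟨rfl, by simpa [hb] using h, rfl⟩
    have hαdiv : α = (β - algebraMap F E y * α ^ 2) /
        (algebraMap F E (x + b * z) + algebraMap F E z * α ^ 2) := by
      rw [eq_div_iff hv]
      ring
    have hβm : β ∈ adjoin F {β, α ^ 2} := subset_adjoin F _ (by simp)
    have hαm : α ^ 2 ∈ adjoin F {β, α ^ 2} := subset_adjoin F _ (by simp)
    have hmem := div_mem
      (sub_mem hβm (mul_mem (IntermediateField.algebraMap_mem _ y) hαm))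
      (add_mem (IntermediateField.algebraMap_mem _ (x + b * z))
        (mul_mem (IntermediateField.algebraMap_mem _ z) hαm))
    rw [← hαdiv] at hmem
    rwa [eq_top_iff, ← hE, adjoin_simple_le_iff]

end Quartic


/-- let `E = F(α)` be a quartic extension of a field of characteristic 2 where
`α` has minimal polynomial `X⁴ + bX² + d` with `b ≠ 0` (so `E/F` is inseparable but not purely
inseparable).  The following are equivalent:
(1) `[F(√b,√d) : F] = 2` (inside an algebraic closure of `F`);
(2) `E` contains an inseparable quadratic subextension `F(√c)` for some `c ∈ F \ F²`, and then
`E = F(√c, α²)` is mixed biquadratic;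
(3) the totally singular form `⟨1,b,d⟩` is isotropic over `F`, i.e. `x² + by² + dz² = 0` has a
nontrivial solution in `F`. -/
theorem stmt_16 (F : Type) [Field F] [CharP F 2] (E : Type) [Field E] [Algebra F E]
    (b d : F) (hb : b ≠ 0) (α : E)
    (hα : α ^ 4 + algebraMap F E b * α ^ 2 + algebraMap F E d = 0)
    (hdim : Module.finrank F E = 4)
    (hE : IntermediateField.adjoin F {α} = ⊤) :
    ((Module.finrank F (IntermediateField.adjoin F
        {x : AlgebraicClosure F | x ^ 2 = algebraMap F (AlgebraicClosure F) b ∨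
          x ^ 2 = algebraMap F (AlgebraicClosure F) d}) = 2) ↔
      (∃ x y z : F, ¬(x = 0 ∧ y = 0 ∧ z = 0) ∧ x ^ 2 + b * y ^ 2 + d * z ^ 2 = 0)) ∧
    ((∃ c : F, (∀ r : F, r ^ 2 ≠ c) ∧ ∃ β : E, β ^ 2 = algebraMap F E c ∧
        IntermediateField.adjoin F {β, α ^ 2} = ⊤) ↔
      (∃ x y z : F, ¬(x = 0 ∧ y = 0 ∧ z = 0) ∧ x ^ 2 + b * y ^ 2 + d * z ^ 2 = 0)) := by
  have : CharP (AlgebraicClosure F) 2 :=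
    charP_of_injective_algebraMap (algebraMap F (AlgebraicClosure F)).injective 2
  refine ⟨?_, ?_, ?_⟩
  · obtain ⟨s, hs⟩ := IsAlgClosed.exists_pow_nat_eq
      (algebraMap F (AlgebraicClosure F) b) two_pos
    obtain ⟨t, ht⟩ := IsAlgClosed.exists_pow_nat_eq
      (algebraMap F (AlgebraicClosure F) d) two_pos
    rw [setOf_sq_eq_or_sq_eq_of_charTwo hs ht]
    exact finrank_adjoin_sqrt_pair_eq_two_iff (not_both_squares hα hdim hE) hs ht
  · rintro ⟨c, hc, β, hβ, -⟩
    exact isotropic_of_exists_sqrt hα hdim hE hc hβ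
  · rintro ⟨x, y, z, hne, h⟩
    exact exists_sqrt_of_isotropic hb hα hdim hE hne h
end
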